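/- arXiv:1810.05335 — 5 statements merged into one kernel-verified Lean document; each statement's English description precedes it below -/
import Mathlib

section
/- Compactness theorem for full Boolean-valued structures: Suppose B is a complete Boolean algebra, L is a first-order language, X is a set, and F is a function from the set L(X) of L-formulas with parameters from X (the elements of X treated as new constant symbols) to B. Then the following are equivalent: (A) there exist a full B-valued L-structure M and a map τ : X → M such that F(φ(ā)) ≤ ‖φ(τ(ā))‖_M for every formula φ(ā) ∈ L(X); (B) for every finite subset Γ0 of L(X) and every nonzero c ∈ B, there exist an ordinary L-structure M and a map τ : X → M such that for every φ(ā) ∈ Γ0, if c ≤ F(φ(ā)) then M ⊨ φ(τ(ā)). -/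
open FirstOrder FirstOrder.Language Cardinal

namespace BVal

/-! ### Filters and ultrafilters on complete Boolean algebras -/

variable {B : Type} [CompleteBooleanAlgebra B]

/-- A filter on a complete Boolean algebra. -/
def IsBFilter (D : Set B) : Prop :=
  ⊤ ∈ D ∧ ⊥ ∉ D ∧ (∀ a b : B, a ∈ D → a ≤ b → b ∈ D) ∧
    (∀ a b : B, a ∈ D → b ∈ D → a ⊓ b ∈ D)

/-- An ultrafilter on a complete Boolean algebra. -/
def IsBUltrafilter (U : Set B) : Prop :=
  IsBFilter U ∧ ∀ a : B, a ∈ U ∨ aᶜ ∈ U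

/-- An antichain in a complete Boolean algebra: pairwise disjoint nonzero elements. -/
def IsBAntichain (S : Set B) : Prop :=
  (∀ a ∈ S, a ≠ ⊥) ∧ S.Pairwise fun a b => a ⊓ b = ⊥

/-- `ccOf B` is the least cardinal `κ` such that every antichain of `B` has cardinality `< κ`. -/
noncomputable def ccOf (B : Type) [CompleteBooleanAlgebra B] : Cardinal :=
  sInf {κ : Cardinal | ∀ S : Set B, IsBAntichain S → Cardinal.mk S < κ}

/-! ### Regularity -/

/-- An `I`-quasiregular family: finite meets are nonzero, countably infinite meets are zero. -/
def IsQuasiregularFamily {I : Type} (a : I → B) : Prop :=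
  (∀ s : Finset I, s.inf a ≠ ⊥) ∧
    ∀ J : Set I, J.Countable → J.Infinite → (⨅ i ∈ J, a i) = ⊥

/-- An `I`-regular family: quasiregular, and the set of nonzero elements deciding
every member of the family is dense. -/
def IsRegularFamily {I : Type} (a : I → B) : Prop :=
  IsQuasiregularFamily a ∧
    ∀ b : B, b ≠ ⊥ → ∃ b' : B, b' ≠ ⊥ ∧ b' ≤ b ∧ ∀ i, b' ≤ a i ∨ b' ≤ (a i)ᶜ

/-- A filter `D` is `lam`-regular if it contains some `lam`-regular family. -/
def IsRegularFilter (D : Set B) (lam : Cardinal) : Prop :=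
  ∃ a : Quotient.out lam → B, IsRegularFamily a ∧ ∀ α, a α ∈ D

/-! ### Boolean-valued structures -/

/-- Plug the tuple `b` into the `Fin`-indexed free variables of the bounded formula `φ`,
relabelling the parameters along `e`. -/
def plugEmb {L : FirstOrder.Language.{0, 0}} {C D : Type} {k : ℕ} (φ : L.BoundedFormula C k)
    (e : C → D) (b : Fin k → D) : L.Formula D :=
  φ.toFormula.relabel (Sum.elim e b)

/-- Plug the tuple `b` into the `Fin`-indexed free variables of the bounded formula `φ`. -/
def plug {L : FirstOrder.Language.{0, 0}} {C : Type} {k : ℕ} (φ : L.BoundedFormula C k)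
    (b : Fin k → C) : L.Formula C :=
  plugEmb φ id b

/-- The finite conjunction of a list of bounded formulas. -/
def listConj {L : FirstOrder.Language.{0, 0}} {α : Type} {n : ℕ} :
    List (L.BoundedFormula α n) → L.BoundedFormula α n
  | [] => ⊤
  | φ :: l => φ ⊓ listConj l

/-- The axioms for a `B`-valued `L`-structure with carrier `C` and evaluation map `val`,
where formulas with parameters from `C` are encoded as `L.Formula C` (the parameters being
the free variables): logically valid formulas get value `⊤`, negation and conjunction are
respected, the value of an existential formula is the supremum of the values of its instances,
and distinct elements are not identified. -/
def IsBVal {L : FirstOrder.Language.{0, 0}} {C : Type} (val : L.Formula C → B) : Prop :=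
  (∀ φ : L.Formula C,
      (∀ (N : Type) [L.Structure N] [Nonempty N] (v : C → N), φ.Realize v) → val φ = ⊤) ∧
  (∀ φ : L.Formula C, val φ.not = (val φ)ᶜ) ∧
  (∀ φ ψ : L.Formula C, val (φ ⊓ ψ) = val φ ⊓ val ψ) ∧
  (∀ φ : L.BoundedFormula C 1, val φ.ex = ⨆ a : C, val (plug φ fun _ => a)) ∧
  (∀ a b : C, a ≠ b → val (Term.equal (Term.var a) (Term.var b)) < ⊤)

/-- Fullness of a `B`-valued structure: every existential value is attained. -/
def IsFull {L : FirstOrder.Language.{0, 0}} {C : Type} (val : L.Formula C → B) : Prop :=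
  ∀ φ : L.BoundedFormula C 1, ∃ a : C, val φ.ex = val (plug φ fun _ => a)

/-- The `B`-valued structure gives every sentence of `T` the value `⊤`. -/
def BModels {L : FirstOrder.Language.{0, 0}} {C : Type} (val : L.Formula C → B) (T : L.Theory) : Prop :=
  ∀ φ ∈ T, val (Formula.relabel (fun e : Empty => e.elim) φ) = ⊤

/-- `val` is a full `B`-valued model of `T`. -/
def IsFullBModel {L : FirstOrder.Language.{0, 0}} (T : L.Theory) {C : Type}
    (val : L.Formula C → B) : Prop :=
  IsBVal val ∧ IsFull val ∧ BModels val T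

/-- An elementary map between `B`-valued structures. -/
def ElemMap {L : FirstOrder.Language.{0, 0}} {C D : Type} (v : L.Formula C → B) (w : L.Formula D → B)
    (f : C → D) : Prop :=
  ∀ φ : L.Formula C, v φ = w (φ.relabel f)

/-- `lam⁺`-saturation for full `B`-valued models of `T`: elementary maps from models of
cardinality at most `lam` extend along elementary extensions. -/
def BSaturated {L : FirstOrder.Language.{0, 0}} (T : L.Theory) (lam : Cardinal) {C : Type}
    (val : L.Formula C → B) : Prop :=
  ∀ (C0 C1 : Type) (v0 : L.Formula C0 → B) (v1 : L.Formula C1 → B),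
    IsFullBModel T v0 → IsFullBModel T v1 → Cardinal.mk C1 ≤ lam →
    ∀ ι : C0 → C1, ElemMap v0 v1 ι →
    ∀ f : C0 → C, ElemMap v0 val f →
    ∃ g : C1 → C, ElemMap v1 val g ∧ g ∘ ι = f

/-- `lam⁺`-universality for full `B`-valued models of `T`. -/
def BUniversal {L : FirstOrder.Language.{0, 0}} (T : L.Theory) (lam : Cardinal) {C : Type}
    (val : L.Formula C → B) : Prop :=
  ∀ (C1 : Type) (v1 : L.Formula C1 → B), IsFullBModel T v1 → Cardinal.mk C1 ≤ lam →
    ∃ f : C1 → C, ElemMap v1 val f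

/-! ### Ordinary structures, specializations, ordinary saturation -/

/-- A bundled (nonempty) ordinary `L`-structure. -/
structure OrdStructure (L : FirstOrder.Language.{0, 0}) : Type 1 where
  carrier : Type
  [str : L.Structure carrier]
  [nonempty' : Nonempty carrier]

attribute [instance] OrdStructure.str OrdStructure.nonempty'

instance {L : FirstOrder.Language.{0, 0}} : CoeSort (OrdStructure L) Type :=
  ⟨OrdStructure.carrier⟩

/-- `(N, π)` is a specialization of the `B`-valued structure `val` at the ultrafilter `U`:
`π` is surjective and a formula holds in `N` of the images iff its value lies in `U`. -/
def IsSpecialization {L : FirstOrder.Language.{0, 0}} {C : Type} (val : L.Formula C → B) (U : Set B)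
    (N : Type) [L.Structure N] (π : C → N) : Prop :=
  Function.Surjective π ∧ ∀ φ : L.Formula C, (val φ ∈ U ↔ φ.Realize π)

/-- An ordinary structure `N` is `lam⁺`-saturated: every finitely satisfiable set of formulas
in one free variable with parameters from a subset of `N` of cardinality at most `lam`
is realized in `N`. -/
def OrdSaturated (L : FirstOrder.Language.{0, 0}) (lam : Cardinal) (N : Type) [L.Structure N] : Prop :=
  ∀ A : Set N, Cardinal.mk A ≤ lam →
    ∀ p : Set (L.BoundedFormula A 1),
      (∀ s : Finset (L.BoundedFormula A 1), ↑s ⊆ p →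
        ∃ b : N, ∀ φ ∈ s, BoundedFormula.Realize φ Subtype.val fun _ => b) →
      ∃ b : N, ∀ φ ∈ p, BoundedFormula.Realize φ Subtype.val fun _ => b

/-- The ultrafilter `U` on `B` `lam⁺`-saturates the theory `T`: for every `lam⁺`-saturated
full `B`-valued model of `T`, every specialization at `U` is `lam⁺`-saturated. -/
def Saturates {L : FirstOrder.Language.{0, 0}} (U : Set B) (T : L.Theory) (lam : Cardinal) : Prop :=
  ∀ (C : Type) (val : L.Formula C → B), IsFullBModel T val → BSaturated T lam val →
    ∀ (N : Type) [L.Structure N] (π : C → N), IsSpecialization val U N π →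
      OrdSaturated L lam N

/-! ### Distributions -/

/-- An `I`-distribution in `B`. -/
def IsDistribution {I : Type} (A : Finset I → B) : Prop :=
  A ∅ = ⊤ ∧ (∀ s, A s ≠ ⊥) ∧ ∀ s t : Finset I, s ⊆ t → A t ≤ A s

/-- A multiplicative distribution. -/
def MultiplicativeDist {I : Type} (A : Finset I → B) : Prop :=
  ∀ s : Finset I, A s = s.inf fun i => A {i}

/-- `A'` refines `A`. -/
def Refines {I : Type} (A' A : Finset I → B) : Prop :=
  ∀ s, A' s ≤ A s

/-- `A'` conservatively refines `A`. -/
def ConsRefines {I : Type} (A' A : Finset I → B) : Prop :=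
  ∀ s : Finset I, A' s = A s ⊓ s.inf fun i => A' {i}

/-- The distribution `A` lies in the filter `D`. -/
def InFilter {I : Type} (A : Finset I → B) (D : Set B) : Prop :=
  ∀ s, A s ∈ D

/-- `A` has a multiplicative refinement in `D`. -/
def HasMultRefinement {I : Type} (A : Finset I → B) (D : Set B) : Prop :=
  ∃ A' : Finset I → B, IsDistribution A' ∧ MultiplicativeDist A' ∧ InFilter A' D ∧ Refines A' A

/-- A filter `D` is `lam⁺`-good if every `lam`-distribution in `D` has a multiplicative
refinement in `D`. -/
def IsGoodFilter (D : Set B) (lam : Cardinal) : Prop :=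
  ∀ A : Finset (Quotient.out lam) → B, IsDistribution A → InFilter A D →
    HasMultRefinement A D

/-- A distribution is regular if the family of its values at singletons is regular. -/
def IsRegularDistribution {I : Type} (A : Finset I → B) : Prop :=
  IsRegularFamily fun i => A {i}

/-! ### Łoś maps and possibilities -/

/-- An `I`-sequence of formulas `φ_i(x̄, ȳ_i)`: `x̄` has length `n`, `ȳ_i` has length `m i`. -/
structure FormulaSeq (L : FirstOrder.Language.{0, 0}) (I : Type) : Type 1 where
  n : ℕ
  m : I → ℕ
  φ : ∀ i, L.Formula (Fin n ⊕ Fin (m i))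

/-- The formula `∃ x̄, ⋀_{i ∈ s} φ_i(x̄, ā_i)`, with parameters `a`. -/
noncomputable def losFormula {L : FirstOrder.Language.{0, 0}} {C I : Type} (Φ : FormulaSeq L I)
    (a : ∀ i, Fin (Φ.m i) → C) (s : Finset I) : L.Formula C :=
  BoundedFormula.exs (listConj (s.toList.map fun i =>
    BoundedFormula.relabel
      (fun v : Fin Φ.n ⊕ Fin (Φ.m i) =>
        Sum.elim (fun k => Sum.inr k) (fun j => Sum.inl (a i j)) v)
      (Φ.φ i)))

/-- `A` is a `(I, T, Φ)`-Łoś map. -/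
def IsLosMapFor {L : FirstOrder.Language.{0, 0}} (T : L.Theory) {I : Type} (A : Finset I → B)
    (Φ : FormulaSeq L I) : Prop :=
  ∃ (C : Type) (val : L.Formula C → B), IsFullBModel T val ∧
    ∃ a : ∀ i, Fin (Φ.m i) → C, ∀ s : Finset I, A s = val (losFormula Φ a s)

/-- `A` is a `(I, T)`-Łoś map. -/
def IsLosMap {L : FirstOrder.Language.{0, 0}} (T : L.Theory) {I : Type} (A : Finset I → B) : Prop :=
  ∃ Φ : FormulaSeq L I, IsLosMapFor T A Φ

/-- `A` is a `(I, T)`-Łoś map witnessed by a formula sequence whose `x̄` has length `k`. -/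
def IsLosMapOfArity {L : FirstOrder.Language.{0, 0}} (T : L.Theory) {I : Type} (A : Finset I → B)
    (k : ℕ) : Prop :=
  ∃ Φ : FormulaSeq L I, Φ.n = k ∧ IsLosMapFor T A Φ

/-- `A` is a `(I, T)`-possibility: it conservatively refines some `(I, T)`-Łoś map. -/
def IsPossibility {L : FirstOrder.Language.{0, 0}} (T : L.Theory) {I : Type} (A : Finset I → B) : Prop :=
  ∃ A0 : Finset I → B, IsDistribution A0 ∧ IsLosMap T A0 ∧ ConsRefines A A0

/-! ### Partial types -/

/-- `p` is a partial type over the `B`-valued structure `val`: each finite conjunction has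
nonzero existential value. -/
def IsPartialType {L : FirstOrder.Language.{0, 0}} {C : Type} (val : L.Formula C → B) {k : ℕ}
    (p : Set (L.BoundedFormula C k)) : Prop :=
  ∀ Γ : Finset (L.BoundedFormula C k), ↑Γ ⊆ p →
    val (BoundedFormula.exs (listConj Γ.toList)) ≠ ⊥

/-- `p` is a partial `U`-type over `val`: each finite conjunction has existential value in `U`. -/
def IsUType {L : FirstOrder.Language.{0, 0}} {C : Type} (val : L.Formula C → B) (U : Set B) {k : ℕ}
    (p : Set (L.BoundedFormula C k)) : Prop :=
  ∀ Γ : Finset (L.BoundedFormula C k), ↑Γ ⊆ p →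
    val (BoundedFormula.exs (listConj Γ.toList)) ∈ U

/-- The Łoś map of the partial type `p`, as a `p`-distribution. -/
noncomputable def losOfType {L : FirstOrder.Language.{0, 0}} {C : Type} (val : L.Formula C → B) {k : ℕ}
    (p : Set (L.BoundedFormula C k)) : Finset ↥p → B := fun Γ =>
  val (BoundedFormula.exs (listConj (Γ.toList.map Subtype.val)))

/-! ### Boolean ultrapowers -/

/-- The carrier of the Boolean ultrapower `M^B`: maximal antichains indexed by `M`. -/
def BUP (B : Type) [CompleteBooleanAlgebra B] (M : Type) : Type :=
  {a : M → B // (∀ m m' : M, m ≠ m' → a m ⊓ a m' = ⊥) ∧ (⨆ m, a m) = ⊤}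

/-- The evaluation map of the Boolean ultrapower `M^B`. -/
noncomputable def bupVal (B : Type) [CompleteBooleanAlgebra B] {L : FirstOrder.Language.{0, 0}}
    (M : Type) [L.Structure M] : L.Formula (BUP B M) → B := fun φ =>
  letI : DecidableEq (BUP B M) := Classical.decEq _
  ⨆ (w : BUP B M → M) (_ : φ.Realize w), φ.freeVarFinset.inf fun c => c.1 (w c)

/-- A bundled complete Boolean algebra. -/
structure CBA : Type 1 where
  carrier : Type
  [str : CompleteBooleanAlgebra carrier]

attribute [instance] CBA.str

instance : CoeSort CBA Type := ⟨CBA.carrier⟩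

end BVal

open BVal

namespace BValProof

section Abstract

variable {B : Type} [CompleteBooleanAlgebra B] {W : Type} {S : Type}

/-- Consistency of a `B`-valued assignment on formulas w.r.t. a satisfaction relation. -/
def Con (R : W → S → Prop) (G : S → B) : Prop :=
  ∀ (Γ : Finset S) (c : B), c ≠ ⊥ → (∀ φ ∈ Γ, c ≤ G φ) → ∃ w, ∀ φ ∈ Γ, R w φ

theorem refine_sSup (f : S → Set B) (Γ : Finset S) :
    ∀ c : B, c ≠ ⊥ → (∀ φ ∈ Γ, c ≤ sSup (f φ)) →
      ∃ c', c' ≠ ⊥ ∧ c' ≤ c ∧ ∀ φ ∈ Γ, ∃ b ∈ f φ, c' ≤ b := by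
  classical
  induction Γ using Finset.induction_on with
  | empty => intro c hc _; exact ⟨c, hc, le_rfl, by simp⟩
  | insert a s ha ih =>
    intro c hc h
    obtain ⟨c', hc', hle, h'⟩ := ih c hc fun φ hφ => h φ (Finset.mem_insert_of_mem hφ)
    have h1 : c' ≤ sSup (f a) := hle.trans (h a (Finset.mem_insert_self _ _))
    have h2 : ∃ b ∈ f a, c' ⊓ b ≠ ⊥ := by
      by_contra hcon
      push Not at hcon
      apply hc'
      rw [← inf_eq_left.2 h1, inf_sSup_eq]
      simp only [iSup_eq_bot]
      exact hcon
    obtain ⟨b, hb, hne⟩ := h2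
    refine ⟨c' ⊓ b, hne, inf_le_left.trans hle, ?_⟩
    intro φ hφ
    rcases Finset.mem_insert.1 hφ with rfl | hφ
    · exact ⟨b, hb, inf_le_right⟩
    · obtain ⟨b', hb', hl⟩ := h' φ hφ
      exact ⟨b', hb', inf_le_left.trans hl⟩

theorem chain_bound (c : Set (S → B)) (hc : IsChain (· ≤ ·) c) (y : S → B) (hy : y ∈ c)
    (d : B) (Γ : Finset S) (h : ∀ φ ∈ Γ, ∃ G ∈ c, d ≤ G φ) :
    ∃ G ∈ c, ∀ φ ∈ Γ, d ≤ G φ := by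
  classical
  induction Γ using Finset.induction_on with
  | empty => exact ⟨y, hy, by simp⟩
  | insert a s ha ih =>
    obtain ⟨G, hG, h1⟩ := ih fun φ hφ => h φ (Finset.mem_insert_of_mem hφ)
    obtain ⟨G', hG', h2⟩ := h a (Finset.mem_insert_self _ _)
    rcases hc.total hG hG' with hle | hle
    · refine ⟨G', hG', fun φ hφ => ?_⟩
      rcases Finset.mem_insert.1 hφ with rfl | hφ
      · exact h2
      · exact (h1 φ hφ).trans (hle φ)
    · refine ⟨G, hG, fun φ hφ => ?_⟩
      rcases Finset.mem_insert.1 hφ with rfl | hφ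
      · exact h2.trans (hle _)
      · exact h1 φ hφ

theorem exists_maximal (R : W → S → Prop) (F : S → B) (hF : Con R F) :
    ∃ G : S → B, F ≤ G ∧ Maximal (Con R) G := by
  refine zorn_le_nonempty₀ {G | Con R G} ?_ F hF
  intro c hcs hc y hy
  refine ⟨fun φ => sSup ((fun G : S → B => G φ) '' c), ?_, ?_⟩
  · intro Γ d hd h
    obtain ⟨d', hd', _, h'⟩ := refine_sSup (fun φ => (fun G : S → B => G φ) '' c) Γ d hd h
    obtain ⟨G, hG, hle⟩ := chain_bound c hc y hy d' Γ (by
      intro φ hφ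
      obtain ⟨b, ⟨G, hG, rfl⟩, hb⟩ := h' φ hφ
      exact ⟨G, hG, hb⟩)
    exact hcs hG Γ d' hd' hle
  · intro z hz φ
    exact le_sSup ⟨z, hz, rfl⟩

variable {R : W → S → Prop} {G : S → B}

theorem key (hG : Maximal (Con R) G) (φ : S) (d : B)
    (h : ∀ (Γ : Finset S) (c : B), c ≠ ⊥ → c ≤ d → (∀ ψ ∈ Γ, c ≤ G ψ) →
      ∃ w, R w φ ∧ ∀ ψ ∈ Γ, R w ψ) : d ≤ G φ := by
  classical
  have hcon : Con R (Function.update G φ (G φ ⊔ d)) := by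
    intro Γ c hc hΓ
    have hrest : ∀ ψ ∈ Γ.erase φ, c ≤ G ψ := by
      intro ψ hψ
      have := hΓ ψ (Finset.mem_of_mem_erase hψ)
      rwa [Function.update_of_ne (Finset.ne_of_mem_erase hψ)] at this
    by_cases hφ : φ ∈ Γ
    · have hle := hΓ φ hφ
      rw [Function.update_self] at hle
      by_cases h0 : c ⊓ G φ = ⊥
      · have hcd : c ≤ d := Disjoint.left_le_of_le_sup_left hle (disjoint_iff.2 h0)
        obtain ⟨w, hw, hw'⟩ := h (Γ.erase φ) c hc hcd hrest
        refine ⟨w, fun ψ hψ => ?_⟩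
        by_cases e : ψ = φ
        · rw [e]; exact hw
        · exact hw' ψ (Finset.mem_erase.2 ⟨e, hψ⟩)
      · refine hG.prop Γ (c ⊓ G φ) h0 fun ψ hψ => ?_
        by_cases e : ψ = φ
        · rw [e]; exact inf_le_right
        · exact inf_le_left.trans (hrest ψ (Finset.mem_erase.2 ⟨e, hψ⟩))
    · rw [Finset.erase_eq_of_notMem hφ] at hrest
      exact hG.prop Γ c hc hrest
  have hle : G ≤ Function.update G φ (G φ ⊔ d) := by
    intro ψ
    by_cases e : ψ = φ
    · rw [e, Function.update_self]; exact le_sup_left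
    · rw [Function.update_of_ne e]
  have := hG.le_of_ge hcon hle φ
  rw [Function.update_self] at this
  exact le_sup_right.trans this

theorem ent (hG : Maximal (Con R) G) (Γ : Finset S) (c : B) (hc : ∀ ψ ∈ Γ, c ≤ G ψ) (φ : S)
    (h : ∀ w, (∀ ψ ∈ Γ, R w ψ) → R w φ) : c ≤ G φ := by
  classical
  refine key hG φ c fun Γ' c' hc' hle h' => ?_
  obtain ⟨w, hw⟩ := hG.prop (Γ ∪ Γ') c' hc' (by
    intro ψ hψ
    rcases Finset.mem_union.1 hψ with hψ | hψ
    · exact hle.trans (hc ψ hψ)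
    · exact h' ψ hψ)
  exact ⟨w, h w fun ψ hψ => hw ψ (Finset.mem_union_left _ hψ),
    fun ψ hψ => hw ψ (Finset.mem_union_right _ hψ)⟩

theorem mono (hG : Maximal (Con R) G) {φ ψ : S} (h : ∀ w, R w φ → R w ψ) : G φ ≤ G ψ :=
  ent hG {φ} (G φ) (by simp) ψ fun w hw => h w (hw φ (by simp))

theorem congr (hG : Maximal (Con R) G) {φ ψ : S} (h : ∀ w, R w φ ↔ R w ψ) : G φ = G ψ :=
  le_antisymm (mono hG fun w => (h w).1) (mono hG fun w => (h w).2)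

theorem top (hG : Maximal (Con R) G) {φ : S} (h : ∀ w, R w φ) : G φ = ⊤ :=
  top_le_iff.1 (ent hG ∅ ⊤ (by simp) φ fun w _ => h w)

theorem neg (hG : Maximal (Con R) G) {φ ψ : S} (h : ∀ w, R w ψ ↔ ¬ R w φ) :
    G ψ = (G φ)ᶜ := by
  classical
  apply le_antisymm
  · rw [le_compl_iff_disjoint_right, disjoint_iff]
    by_contra h0
    obtain ⟨w, hw⟩ := hG.prop {φ, ψ} _ h0 (by simp)
    exact (h w).1 (hw ψ (by simp)) (hw φ (by simp))
  · refine key hG ψ _ fun Γ c hc hle hΓ => ?_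
    by_contra hcon
    push Not at hcon
    have h1 : c ≤ G φ := by
      refine ent hG Γ c hΓ φ fun w hw => ?_
      by_contra hn
      obtain ⟨χ, hχ, hχ'⟩ := hcon w ((h w).2 hn)
      exact hχ' (hw χ hχ)
    apply hc
    rw [← le_bot_iff, ← inf_compl_eq_bot (a := G φ)]
    exact le_inf h1 hle

theorem conj (hG : Maximal (Con R) G) {φ ψ χ : S} (h : ∀ w, R w χ ↔ R w φ ∧ R w ψ) :
    G χ = G φ ⊓ G ψ := by
  classical
  apply le_antisymm
  · exact le_inf (mono hG fun w hw => ((h w).1 hw).1) (mono hG fun w hw => ((h w).1 hw).2)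
  · exact ent hG {φ, ψ} _ (by simp) χ fun w hw => (h w).2 ⟨hw φ (by simp), hw ψ (by simp)⟩

end Abstract

section Logic

variable {L : FirstOrder.Language.{0, 0}}

theorem realize_of_agree {α : Type} [DecidableEq α] {N : Type} [L.Structure N] (φ : L.Formula α)
    (v v' : α → N) (h : ∀ a ∈ BoundedFormula.freeVarFinset φ, v a = v' a) :
    φ.Realize v ↔ φ.Realize v' := by
  have h1 := BoundedFormula.realize_restrictFreeVar (φ := φ) (f := fun a => (a : α))
    (v := v) (xs := default) v (fun _ => rfl)
  have h2 := BoundedFormula.realize_restrictFreeVar (φ := φ) (f := fun a => (a : α))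
    (v := v) (xs := default) v' (fun a => h a a.2)
  exact h1.symm.trans h2

theorem realize_plug {C N : Type} [L.Structure N] (φ : L.BoundedFormula C 1) (a : C) (v : C → N) :
    (plug φ fun _ => a).Realize v ↔ φ.Realize v (fun _ => v a) := by
  unfold plug plugEmb
  rw [Formula.realize_relabel, BoundedFormula.realize_toFormula]
  rfl

theorem realize_ex' {C N : Type} [L.Structure N] (φ : L.BoundedFormula C 1) (v : C → N) :
    Formula.Realize φ.ex v ↔ ∃ a : N, φ.Realize v (fun _ => a) := by
  unfold Formula.Realize
  rw [BoundedFormula.realize_ex]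
  refine exists_congr fun a => ?_
  have : (Fin.snoc default a : Fin 1 → N) = fun _ => a := by
    funext i
    simp [Fin.snoc]
  rw [← this]

variable {B : Type} [CompleteBooleanAlgebra B]

theorem forward {C : Type} (val : L.Formula C → B) (hval : IsBVal val) (c : B)
    (Γ : Finset (L.Formula C)) (h : ∀ φ ∈ Γ, c ≤ val φ) :
    ∃ ψ : L.Formula C, c ≤ val ψ ∧ ∀ (N : Type) [L.Structure N] (v : C → N),
      ψ.Realize v → ∀ φ ∈ Γ, φ.Realize v := by
  classical
  obtain ⟨hv, hn, hi, -⟩ := hval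
  induction Γ using Finset.induction_on with
  | empty =>
    refine ⟨⊤, ?_, by simp⟩
    rw [hv ⊤ (by intros; simp [Formula.Realize])]
    exact le_top
  | insert a s ha ih =>
    obtain ⟨ψ, h1, h2⟩ := ih fun φ hφ => h φ (Finset.mem_insert_of_mem hφ)
    refine ⟨a ⊓ ψ, ?_, ?_⟩
    · rw [hi]; exact le_inf (h a (Finset.mem_insert_self _ _)) h1
    · intro N _ v hr φ hφ
      rw [Formula.realize_inf] at hr
      rcases Finset.mem_insert.1 hφ with rfl | hφ
      · exact hr.1
      · exact h2 N v hr.2 φ hφ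

/-- Satisfaction at an index, for formulas with choice functions as parameters. -/
def Sat {W : Type} (N : W → OrdStructure L) (w : W) (φ : L.Formula ((w : W) → (N w).carrier)) :
    Prop :=
  φ.Realize fun f => f w

theorem relabel_congr {W : Type} {N : W → OrdStructure L}
    {G : L.Formula ((w : W) → (N w).carrier) → B} (hG : Maximal (Con (Sat N)) G)
    {α : Type} (φ : L.Formula α) (f g : α → ((w : W) → (N w).carrier))
    (h : ∀ a, G (Term.equal (Term.var (f a)) (Term.var (g a))) = ⊤) :
    G (φ.relabel f) ≤ G (φ.relabel g) := by
  classical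
  refine ent hG (insert (φ.relabel f) ((BoundedFormula.freeVarFinset φ).image fun a =>
    (Term.equal (Term.var (f a)) (Term.var (g a)) : L.Formula _))) _ ?_ _ ?_
  · intro ψ hψ
    rcases Finset.mem_insert.1 hψ with rfl | hψ
    · exact le_rfl
    · obtain ⟨a, -, rfl⟩ := Finset.mem_image.1 hψ
      rw [h]; exact le_top
  · intro w hw
    have h1 := hw (φ.relabel f) (Finset.mem_insert_self _ _)
    unfold Sat at h1 ⊢
    rw [Formula.realize_relabel] at h1 ⊢
    refine (realize_of_agree φ _ _ fun a ha => ?_).1 h1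
    have h2 := hw _ (Finset.mem_insert_of_mem (Finset.mem_image_of_mem _ ha))
    unfold Sat at h2
    rw [Formula.realize_equal] at h2
    exact h2

theorem backward (X : Type) (F : L.Formula X → B)
    (H : ∀ (Γ0 : Finset (L.Formula X)) (c : B), c ≠ ⊥ →
        ∃ (N : OrdStructure L) (τ : X → N.carrier),
          ∀ φ ∈ Γ0, c ≤ F φ → φ.Realize τ) :
    ∃ (C : Type) (val : L.Formula C → B), IsBVal val ∧ IsFull val ∧
        ∃ τ : X → C, ∀ φ : L.Formula X, F φ ≤ val (φ.relabel τ) := by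
  classical
  let W : Type := Finset (L.Formula X) × {c : B // c ≠ ⊥}
  have H' : ∀ w : W, ∃ (N : OrdStructure L) (τ : X → N.carrier),
      ∀ φ ∈ w.1, (w.2 : B) ≤ F φ → φ.Realize τ := fun w => H w.1 w.2 w.2.2
  choose N t ht using H'
  let C : Type := (w : W) → (N w).carrier
  let τ : X → C := fun x w => t w x
  let F' : L.Formula C → B := fun φ => sSup (F '' {ψ | ψ.relabel τ = φ})
  have hF' : Con (Sat N) F' := by
    intro Γ c hc h
    obtain ⟨c', hc', -, h'⟩ := refine_sSup (fun φ => F '' {ψ | ψ.relabel τ = φ}) Γ c hc h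
    have h'' : ∀ φ : Γ, ∃ ψ : L.Formula X, ψ.relabel τ = φ ∧ c' ≤ F ψ := by
      intro φ
      obtain ⟨b, ⟨ψ, hψ, rfl⟩, hb⟩ := h' φ φ.2
      exact ⟨ψ, hψ, hb⟩
    choose p hp hp' using h''
    refine ⟨(Finset.univ.image p, ⟨c', hc'⟩), fun φ hφ => ?_⟩
    have := ht (Finset.univ.image p, ⟨c', hc'⟩) (p ⟨φ, hφ⟩)
      (Finset.mem_image_of_mem _ (Finset.mem_univ _)) (hp' ⟨φ, hφ⟩)
    have e := hp ⟨φ, hφ⟩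
    dsimp only at e
    rw [← e]
    unfold Sat
    rw [Formula.realize_relabel]
    exact this
  obtain ⟨G, hFG, hG⟩ := exists_maximal (Sat N) F' hF'
  have heq : ∀ (a b : C) (w : W),
      Sat N w (Term.equal (Term.var a) (Term.var b)) ↔ a w = b w := by
    intro a b w
    unfold Sat
    rw [Formula.realize_equal]
    rfl
  let E : Setoid C :=
    { r := fun a b => G (Term.equal (Term.var a) (Term.var b)) = ⊤
      iseqv := by
        refine ⟨fun a => top hG fun w => (heq _ _ _).2 rfl, fun {a b} h => ?_,
          fun {a b c} h1 h2 => ?_⟩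
        · rw [← top_le_iff, ← h]
          exact mono hG fun w hw => (heq _ _ _).2 ((heq _ _ _).1 hw).symm
        · rw [← top_le_iff]
          refine ent hG {Term.equal (Term.var a) (Term.var b),
            Term.equal (Term.var b) (Term.var c)} ⊤ (by simp [h1, h2]) _ fun w hw => ?_
          exact (heq _ _ _).2 (((heq a b _).1 (hw _ (by simp))).trans
            ((heq b c _).1 (hw _ (by simp)))) }
  let D : Type := Quotient E
  let o : D → C := Quotient.out
  have ho : ∀ a : C, G (Term.equal (Term.var a) (Term.var (o (Quotient.mk E a)))) = ⊤ :=
    fun a => E.symm (Quotient.mk_out a)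
  let val : L.Formula D → B := fun φ => G (φ.relabel o)
  have hsat : ∀ (φ : L.Formula D) (w : W),
      Sat N w (φ.relabel o) ↔ φ.Realize (fun d => o d w) := by
    intro φ w
    unfold Sat
    rw [Formula.realize_relabel]
    rfl
  have hge : ∀ (φ : L.BoundedFormula D 1) (a : D), val (plug φ fun _ => a) ≤ val φ.ex := by
    intro φ a
    refine mono hG fun w hw => ?_
    rw [hsat, realize_plug] at hw
    rw [hsat, realize_ex']
    exact ⟨_, hw⟩
  have hatt : ∀ φ : L.BoundedFormula D 1, ∃ a : D, val φ.ex ≤ val (plug φ fun _ => a) := by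
    intro φ
    have hf : ∀ w : W, ∃ x : (N w).carrier, Formula.Realize φ.ex (fun d => o d w) →
        φ.Realize (fun d => o d w) (fun _ => x) := by
      intro w
      by_cases h : Formula.Realize φ.ex (fun d => o d w)
      · obtain ⟨x, hx⟩ := (realize_ex' _ _).1 h
        exact ⟨x, fun _ => hx⟩
      · exact ⟨Classical.arbitrary _, fun h' => absurd h' h⟩
    choose f hf using hf
    refine ⟨Quotient.mk E f, ?_⟩
    have h1 : val φ.ex ≤ G (φ.toFormula.relabel (Sum.elim o fun _ => f)) := by
      refine mono hG fun w hw => ?_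
      rw [hsat] at hw
      unfold Sat
      rw [Formula.realize_relabel, BoundedFormula.realize_toFormula]
      exact hf w hw
    have h2 := relabel_congr hG φ.toFormula (Sum.elim o fun _ => f)
      (Sum.elim o fun _ => o (Quotient.mk E f)) (by
        rintro (a | a)
        · exact E.refl _
        · exact ho f)
    refine h1.trans (h2.trans (mono hG fun w hw => ?_))
    rw [hsat, realize_plug]
    unfold Sat at hw
    rw [Formula.realize_relabel, BoundedFormula.realize_toFormula] at hw
    exact hw
  refine ⟨D, val, ⟨?_, ?_, ?_, ?_, ?_⟩, ?_, fun x => Quotient.mk E (τ x), ?_⟩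
  · intro φ h
    exact top hG fun w => (hsat _ _).2 (h _ _)
  · intro φ
    exact neg hG fun w => by rw [hsat, hsat]; rfl
  · intro φ ψ
    exact conj hG fun w => by rw [hsat, hsat, hsat, Formula.realize_inf]
  · intro φ
    obtain ⟨a, ha⟩ := hatt φ
    exact le_antisymm (ha.trans (le_iSup (fun a => val (plug φ fun _ => a)) a))
      (iSup_le (hge φ))
  · intro a b hab
    rw [lt_top_iff_ne_top]
    intro h
    apply hab
    have h3 : E.r (o a) (o b) := by
      change G _ = ⊤
      rw [← top_le_iff, ← h]
      refine mono hG fun w hw => ?_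
      rw [hsat, Formula.realize_equal] at hw
      exact (heq _ _ _).2 hw
    have h4 : Quotient.mk E (o a) = Quotient.mk E (o b) := Quotient.sound h3
    rwa [Quotient.out_eq, Quotient.out_eq] at h4
  · intro φ
    obtain ⟨a, ha⟩ := hatt φ
    exact ⟨a, le_antisymm ha (hge φ a)⟩
  · intro φ
    have h1 : F φ ≤ G (φ.relabel τ) := by
      refine le_trans ?_ (hFG (φ.relabel τ))
      exact le_sSup ⟨φ, rfl, rfl⟩
    refine h1.trans ((relabel_congr hG φ τ (fun x => o (Quotient.mk E (τ x)))
      fun x => ho (τ x)).trans (mono hG fun w hw => ?_))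
    rw [hsat, Formula.realize_relabel]
    unfold Sat at hw
    rw [Formula.realize_relabel] at hw
    exact hw

end Logic

end BValProof

/-- **Compactness theorem for full Boolean-valued structures** (Theorem 0.4 / Corollary 2.9). -/
theorem stmt0_compactness (B : Type) [CompleteBooleanAlgebra B]
    (L : FirstOrder.Language.{0, 0}) (X : Type) (F : L.Formula X → B) :
    (∃ (C : Type) (val : L.Formula C → B), IsBVal val ∧ IsFull val ∧
        ∃ τ : X → C, ∀ φ : L.Formula X, F φ ≤ val (φ.relabel τ)) ↔
    (∀ (Γ0 : Finset (L.Formula X)) (c : B), c ≠ ⊥ →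
        ∃ (N : OrdStructure L) (τ : X → N.carrier),
          ∀ φ ∈ Γ0, c ≤ F φ → φ.Realize τ) := by

  classical
  constructor
  · rintro ⟨C, val, hval, -, τ, hτ⟩ Γ0 c hc
    obtain ⟨ψ, h1, h2⟩ := BValProof.forward val hval c
      ((Γ0.filter fun φ => c ≤ F φ).image fun φ => φ.relabel τ) (by
        intro φ hφ
        obtain ⟨χ, hχ, rfl⟩ := Finset.mem_image.1 hφ
        exact (Finset.mem_filter.1 hχ).2.trans (hτ χ))
    by_contra hcon
    have hv : val ψ.not = ⊤ := by
      refine hval.1 _ fun N _ _ v hr => hcon ⟨⟨N⟩, v ∘ τ, fun φ hφ hle => ?_⟩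
      have := h2 N v hr (φ.relabel τ)
        (Finset.mem_image_of_mem _ (Finset.mem_filter.2 ⟨hφ, hle⟩))
      rwa [Formula.realize_relabel] at this
    rw [hval.2.1, compl_eq_top] at hv
    rw [hv] at h1
    exact hc (le_bot_iff.1 h1)
  · exact BValProof.backward X F
end

section
/- Existence and uniqueness of specializations: Suppose B is a complete Boolean algebra, M is a full B-valued L-structure, and U is an ultrafilter on B. Then there is a pair (N, π) where N is an ordinary L-structure and π : M → N is a surjection such that for every L-formula φ(ā) with parameters from M, ‖φ(ā)‖_M ∈ U if and only if N ⊨ φ(π(ā)). Moreover, if (N', π') is any other such pair, then there is a unique isomorphism σ : N ≅ N' of L-structures with σ ∘ π = π'. -/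
open FirstOrder FirstOrder.Language Cardinal

open BVal

namespace BVal

theorem exists_witness {B : Type} [CompleteBooleanAlgebra B]
    {L : FirstOrder.Language.{0, 0}} {C : Type} {val : L.Formula C → B}
    (hfull : IsFull val) {U : Set B} {N : Type} [L.Structure N] (v : C → N)
    (hv : ∀ φ : L.Formula C, (val φ ∈ U ↔ φ.Realize v))
    {X : Type} (ψ : L.Formula (X ⊕ Unit)) (c : X → C) (a : N)
    (h : ψ.Realize (Sum.elim (v ∘ c) (fun _ => a))) :
    ∃ b : C, ψ.Realize (Sum.elim (v ∘ c) (fun _ => v b)) := by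
  let g : X ⊕ Unit → C ⊕ Fin 1 := Sum.map c (fun _ => 0)
  let φ : L.BoundedFormula C 1 := BoundedFormula.relabel g ψ
  have key : ∀ x : N, φ.Realize v (fun _ => x) ↔
      ψ.Realize (Sum.elim (v ∘ c) (fun _ => x)) := by
    intro x
    have := BoundedFormula.realize_relabel (φ := ψ) (g := g) (v := v)
      (xs := fun _ : Fin (1 + 0) => x)
    refine this.trans ?_
    rw [Formula.boundedFormula_realize_eq_realize]
    have e : (Sum.elim v ((fun _ : Fin (1 + 0) => x) ∘ Fin.castAdd 0) ∘ g)
        = Sum.elim (v ∘ c) (fun _ => x) := by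
      funext i
      rcases i with i | i <;> rfl
    rw [e]
  have h1 : Formula.Realize (BoundedFormula.ex φ) v := by
    rw [Formula.Realize, BoundedFormula.realize_ex]
    refine ⟨a, ?_⟩
    have e : (Fin.snoc (default : Fin 0 → N) a : Fin 1 → N) = fun _ => a := by
      funext i
      obtain rfl : i = Fin.last 0 := Subsingleton.elim (α := Fin 1) _ _
      exact Fin.snoc_last (α := fun _ => N) a default
    rw [e]
    exact (key a).2 h
  obtain ⟨b, hb⟩ := hfull φ
  refine ⟨b, (key _).1 ?_⟩
  have h2 := (hv _).2 h1
  rw [hb, hv, plug, plugEmb, Formula.realize_relabel, BoundedFormula.realize_toFormula] at h2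
  exact h2

theorem realize_listConj {L : FirstOrder.Language.{0, 0}} {C : Type} {N : Type} [L.Structure N]
    (v : C → N) (l : List (L.Formula C)) (h : Formula.Realize (listConj l) v) :
    ∀ φ ∈ l, φ.Realize v := by
  induction l with
  | nil => simp
  | cons a l ih =>
    have h' : Formula.Realize a v ∧ Formula.Realize (listConj l) v :=
      BoundedFormula.realize_inf.1 h
    intro φ hφ
    rcases List.mem_cons.1 hφ with rfl | hφ
    · exact h'.1
    · exact ih h'.2 φ hφ

theorem exists_weak {B : Type} [CompleteBooleanAlgebra B]
    {L : FirstOrder.Language.{0, 0}} {C : Type} {val : L.Formula C → B}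
    (hval : IsBVal val) {U : Set B} (hU : IsBUltrafilter U) :
    ∃ (N : Type) (_ : L.Structure N) (v : C → N),
      ∀ φ : L.Formula C, (val φ ∈ U ↔ φ.Realize v) := by
  obtain ⟨hvalid, hnot, hinf, -, -⟩ := hval
  obtain ⟨⟨htop, hbot, hup, hmeet⟩, hultra⟩ := hU
  have hconj : ∀ l : List (L.Formula C), (∀ φ ∈ l, val φ ∈ U) → val (listConj l) ∈ U := by
    intro l
    induction l with
    | nil =>
      intro _
      have : val (listConj []) = ⊤ := hvalid _ (fun N _ _ v => BoundedFormula.realize_top.2 trivial)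
      rw [this]; exact htop
    | cons a l ih =>
      intro h
      have : val (listConj (a :: l)) = val a ⊓ val (listConj l) := hinf _ _
      rw [this]
      exact hmeet _ _ (h a (by simp)) (ih fun φ hφ => h φ (by simp [hφ]))
  let T : L[[C]].Theory := {s | val (Formula.equivSentence.symm s) ∈ U}
  have hT : T.IsSatisfiable := by
    rw [Theory.isSatisfiable_iff_isFinitelySatisfiable]
    intro T0 hT0
    by_contra hns
    let l : List (L.Formula C) := T0.toList.map Formula.equivSentence.symm
    have hl : val (listConj l) ∈ U := by
      apply hconj
      intro φ hφ
      obtain ⟨s, hs, rfl⟩ := List.mem_map.1 hφ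
      exact hT0 (by simpa using hs)
    have hn : val (Formula.not (listConj l)) = ⊤ := by
      apply hvalid
      intro N _ _ v
      rw [Formula.realize_not]
      intro hr
      apply hns
      letI := constantsOn.structure v
      have : N ⊨ (T0 : L[[C]].Theory) := by
        refine ⟨fun s hs => ?_⟩
        exact (Formula.realize_equivSentence_symm N s v).1
          (realize_listConj v l hr _ (List.mem_map.2 ⟨s, by simpa using hs, rfl⟩))
      exact Theory.Model.isSatisfiable N
    rw [hnot] at hn
    rw [compl_eq_top.1 hn] at hl
    exact hbot hl
  obtain ⟨N⟩ := hT
  letI : L.Structure N := (L.lhomWithConstants C).reduct N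
  haveI : (L.lhomWithConstants C).IsExpansionOn N := LHom.isExpansionOn_reduct _ _
  have hreal : ∀ φ : L.Formula C, val φ ∈ U → φ.Realize (fun a => (L.con a : N)) := by
    intro φ hφ
    rw [← Formula.realize_equivSentence]
    apply Theory.realize_sentence_of_mem T
    simpa [T] using hφ
  refine ⟨N, inferInstance, fun a => (L.con a : N), fun φ => ⟨hreal φ, fun h => ?_⟩⟩
  rcases hultra (val φ) with h1 | h1
  · exact h1
  · rw [← hnot] at h1
    exact absurd h ((Formula.realize_not).1 (hreal _ h1))

theorem exists_specialization {B : Type} [CompleteBooleanAlgebra B]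
    {L : FirstOrder.Language.{0, 0}} {C : Type} {val : L.Formula C → B}
    (hval : IsBVal val) (hfull : IsFull val) {U : Set B} (hU : IsBUltrafilter U) :
    ∃ (N : OrdStructure L) (π : C → N.carrier), IsSpecialization val U N.carrier π := by
  obtain ⟨N, _, v, hv⟩ := exists_weak hval hU
  let S : L.Substructure N :=
    { carrier := Set.range v
      fun_mem := by
        intro n f x hx
        choose c hc using hx
        obtain rfl : v ∘ c = x := funext hc
        obtain ⟨b, hb⟩ := exists_witness hfull v hv
          (Term.equal (Term.var (Sum.inr ()))
            (Term.func f fun i => Term.var (Sum.inl i)) : L.Formula (Fin n ⊕ Unit)) c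
          (Structure.funMap f (v ∘ c))
          (by simp [Formula.realize_equal, Function.comp_def])
        refine ⟨b, ?_⟩
        simpa [Formula.realize_equal, Function.comp_def] using hb }
  let E : L.ElementarySubstructure N := S.toElementarySubstructure (by
    intro n φ x a h
    have hx : ∀ i, ∃ c, v c = (x i : N) := fun i => (x i).2
    choose c hc using hx
    have hc' : (((↑) : S → N) ∘ x) = v ∘ c := funext fun i => (hc i).symm
    rw [hc'] at h ⊢
    let g : Empty ⊕ Fin (n + 1) → Fin n ⊕ Unit :=
      Sum.elim Empty.elim (Fin.snoc (α := fun _ => Fin n ⊕ Unit) Sum.inl (Sum.inr ()))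
    have key : ∀ y : N, (φ.toFormula.relabel g).Realize (Sum.elim (v ∘ c) (fun _ => y)) ↔
        φ.Realize default (Fin.snoc (v ∘ c) y : Fin (n + 1) → N) := by
      intro y
      rw [Formula.realize_relabel, BoundedFormula.realize_toFormula]
      have e : ((Sum.elim (v ∘ c) (fun _ => y) ∘ g) ∘ Sum.inr)
          = (Fin.snoc (v ∘ c) y : Fin (n + 1) → N) := by
        funext i
        refine Fin.lastCases ?_ (fun j => ?_) i <;> simp [g]
      rw [e, Subsingleton.elim ((Sum.elim (v ∘ c) (fun _ => y) ∘ g) ∘ Sum.inl) default]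
    obtain ⟨b, hb⟩ := exists_witness hfull v hv _ c a ((key a).2 h)
    exact ⟨⟨v b, b, rfl⟩, (key _).1 hb⟩)
  obtain ⟨c0, -⟩ := hfull ⊤
  let π : C → E := fun c => ⟨v c, c, rfl⟩
  haveI : Nonempty E := ⟨π c0⟩
  refine ⟨⟨E⟩, π, ?_, fun φ => ?_⟩
  · rintro ⟨_, c, rfl⟩
    exact ⟨c, rfl⟩
  · rw [hv]
    exact (E.subtype.map_formula φ π)

theorem specialization_unique {B : Type} [CompleteBooleanAlgebra B]
    {L : FirstOrder.Language.{0, 0}} {C : Type} {val : L.Formula C → B} {U : Set B}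
    (N N' : Type) [L.Structure N] [L.Structure N'] (π : C → N) (π' : C → N')
    (h : IsSpecialization val U N π) (h' : IsSpecialization val U N' π') :
    ∃! σ : N ≃[L] N', ∀ x : C, σ (π x) = π' x := by
  obtain ⟨hs, hv⟩ := h
  obtain ⟨hs', hv'⟩ := h'
  have hiff : ∀ φ : L.Formula C, φ.Realize π ↔ φ.Realize π' := fun φ => (hv φ).symm.trans (hv' φ)
  have heq : ∀ a b, π a = π b ↔ π' a = π' b := by
    intro a b
    simpa using hiff (Term.equal (Term.var a) (Term.var b))
  choose r hr using hs
  choose r' hr' using hs'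
  have hπ : ∀ c, π' (r (π c)) = π' c := fun c => (heq _ _).1 (hr _)
  have hπ' : ∀ c, π (r' (π' c)) = π c := fun c => (heq _ _).2 (hr' _)
  let σ : N ≃[L] N' :=
    { toFun := fun n => π' (r n)
      invFun := fun n => π (r' n)
      left_inv := fun n => (hπ' _).trans (hr n)
      right_inv := fun n => (hπ _).trans (hr' n)
      map_fun' := by
        intro n f x
        have := hiff (Term.equal (Term.var (r (Structure.funMap f x)))
          (Term.func f fun i => Term.var (r (x i))))
        simp only [Formula.realize_equal, Term.realize_var, Term.realize_func, hr, true_iff] at this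
        exact this
      map_rel' := by
        intro n R x
        have := hiff (R.formula fun i => Term.var (r (x i)))
        simp only [Formula.realize_rel, Term.realize_var, hr] at this
        exact this.symm }
  refine ⟨σ, fun c => hπ c, fun τ hτ => ?_⟩
  ext n
  rw [← hr n, hτ]
  exact (hπ _).symm

end BVal

/-- **Existence and uniqueness of specializations** (Theorem 2.4). -/
theorem stmt1_specialization (B : Type) [CompleteBooleanAlgebra B]
    (L : FirstOrder.Language.{0, 0}) (C : Type) (val : L.Formula C → B)
    (hval : IsBVal val) (hfull : IsFull val) (U : Set B) (hU : IsBUltrafilter U) :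
    (∃ (N : OrdStructure L) (π : C → N.carrier), IsSpecialization val U N.carrier π) ∧
    (∀ (N N' : Type) [L.Structure N] [L.Structure N'] (π : C → N) (π' : C → N'),
      IsSpecialization val U N π → IsSpecialization val U N' π' →
      ∃! σ : N ≃[L] N', ∀ x : C, σ (π x) = π' x) := by
  exact ⟨exists_specialization hval hfull hU,
    fun N N' _ _ π π' h h' => specialization_unique N N' π π' h h'⟩
end

section
/- Suppose T is a complete countable first-order theory and B is a complete Boolean algebra. Then: (1) (Downward Löwenheim–Skolem) if M is a full B-valued model of T and X ⊆ M, there is a full B-valued model N of T with N ⪯ M, X ⊆ N, and |N| ≤ |X| + ℵ0; (2) (Joint Embedding) if M0 and M1 are full B-valued models of T, there are a full B-valued model N of T and elementary maps f_i : M_i ⪯ N for i = 0, 1; (3) (Amalgamation) if M, M0, M1 are full B-valued models of T with M ⪯ M0 and M ⪯ M1, there are a full B-valued model N of T and elementary maps f_i : M_i ⪯ N for i = 0, 1 such that f_0 and f_1 agree on M. -/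
open FirstOrder FirstOrder.Language Cardinal

open BVal



namespace BValAux

/-! ### A Boolean retraction onto a complete Boolean algebra -/

section Retract

variable {B : Type} [CompleteBooleanAlgebra B] {X : Type}

/-- Ideals of sets meeting the image of `h` trivially. -/
def GoodIdeal (h : B → Set X) (I : Set (Set X)) : Prop :=
  ∅ ∈ I ∧ (∀ p q, p ∈ I → q ⊆ p → q ∈ I) ∧ (∀ p q, p ∈ I → q ∈ I → p ∪ q ∈ I) ∧
    ∀ b, h b ∈ I → b = ⊥

theorem exists_maximal_good (h : B → Set X) (h0 : ∀ b, h b = ∅ → b = ⊥) :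
    ∃ I, GoodIdeal h I ∧
      ∀ p, p ∉ I → ∃ c, c ≠ ⊥ ∧ ∃ i ∈ I, h c ⊆ p ∪ i := by
  obtain ⟨I, -, hI⟩ := zorn_subset_nonempty {I | GoodIdeal h I} (by
    intro c hc hch hne
    refine ⟨⋃₀ c, ⟨?_, ?_, ?_, ?_⟩, fun s hs => Set.subset_sUnion_of_mem hs⟩
    · obtain ⟨J, hJ⟩ := hne
      exact ⟨J, hJ, (hc hJ).1⟩
    · rintro p q ⟨J, hJ, hp⟩ hq
      exact ⟨J, hJ, (hc hJ).2.1 p q hp hq⟩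
    · rintro p q ⟨J, hJ, hp⟩ ⟨K, hK, hq⟩
      rcases hch.total hJ hK with hle | hle
      · exact ⟨K, hK, (hc hK).2.2.1 p q (hle hp) hq⟩
      · exact ⟨J, hJ, (hc hJ).2.2.1 p q hp (hle hq)⟩
    · rintro b ⟨J, hJ, hp⟩
      exact (hc hJ).2.2.2 b hp) {∅} (by
    refine ⟨rfl, ?_, ?_, ?_⟩
    · intro p q hp hq
      rw [Set.mem_singleton_iff] at hp ⊢
      subst hp
      exact Set.subset_empty_iff.1 hq
    · intro p q hp hq
      rw [Set.mem_singleton_iff] at *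
      simp [hp, hq]
    · intro b hb
      exact h0 b hb)
  have hg : GoodIdeal h I := hI.prop
  refine ⟨I, hg, ?_⟩
  intro p hp
  by_contra hcon
  push Not at hcon
  apply hp
  have hJ : GoodIdeal h {q | ∃ i ∈ I, q ⊆ p ∪ i} := by
    refine ⟨⟨∅, hg.1, Set.empty_subset _⟩, ?_, ?_, ?_⟩
    · rintro q q' ⟨i, hi, hq⟩ hq'
      exact ⟨i, hi, hq'.trans hq⟩
    · rintro q q' ⟨i, hi, hq⟩ ⟨i', hi', hq'⟩
      refine ⟨i ∪ i', hg.2.2.1 _ _ hi hi', ?_⟩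
      rintro x (hx | hx)
      · rcases hq hx with h1 | h1
        · exact Or.inl h1
        · exact Or.inr (Or.inl h1)
      · rcases hq' hx with h1 | h1
        · exact Or.inl h1
        · exact Or.inr (Or.inr h1)
    · rintro b ⟨i, hi, hb⟩
      by_contra hb0
      exact hcon b hb0 i hi hb
  have hle : I ⊆ {q | ∃ i ∈ I, q ⊆ p ∪ i} :=
    fun i hi => ⟨i, hi, Set.subset_union_right⟩
  exact hI.le_of_ge hJ hle ⟨∅, hg.1, Set.subset_union_left⟩

theorem exists_retract (h : B → Set X) (h0 : ∀ b, h b = ∅ → b = ⊥)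
    (hc : ∀ b, h bᶜ = (h b)ᶜ) (hi : ∀ a b, h (a ⊓ b) = h a ∩ h b) :
    ∃ r : Set X → B, (∀ p, r pᶜ = (r p)ᶜ) ∧ (∀ p q, r (p ∩ q) = r p ⊓ r q) ∧
      ∀ b, r (h b) = b := by
  obtain ⟨I, hg, hmax⟩ := exists_maximal_good h h0
  have down := hg.2.1
  have un := hg.2.2.1
  have low : ∀ b b' : B, h b \ h b' ∈ I → b ≤ b' := by
    intro b b' hb
    rw [← sdiff_eq_bot_iff, sdiff_eq]
    apply hg.2.2.2
    rw [hi, hc]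
    exact hb
  have key : ∀ p : Set X, ∃ b : B, h b \ p ∈ I ∧ p \ h b ∈ I := by
    intro p
    refine ⟨sSup {b | h b \ p ∈ I}, ?_, ?_⟩
    · by_contra hcon
      obtain ⟨c, hc0, i, hiI, hci⟩ := hmax _ hcon
      apply hc0
      have h1 : c ≤ sSup {b | h b \ p ∈ I} := by
        apply low
        refine down i _ hiI ?_
        rintro x ⟨hx, hx'⟩
        rcases hci hx with h1 | h1
        · exact absurd h1.1 hx'
        · exact h1
      have h2 : sSup {b | h b \ p ∈ I} ≤ cᶜ := by
        apply sSup_le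
        intro b hb
        apply low
        refine down _ _ (un _ _ hb hiI) ?_
        rintro x ⟨hx, hx'⟩
        rw [hc, Set.mem_compl_iff, not_not] at hx'
        rcases hci hx' with h1 | h1
        · exact Or.inl ⟨hx, h1.2⟩
        · exact Or.inr h1
      have h3 := le_inf le_rfl (h1.trans h2)
      rwa [inf_compl_self, le_bot_iff] at h3
    · by_contra hcon
      obtain ⟨c, hc0, i, hiI, hci⟩ := hmax _ hcon
      apply hc0
      have h1 : c ≤ sSup {b | h b \ p ∈ I} := by
        apply le_sSup
        refine down i _ hiI ?_
        rintro x ⟨hx, hx'⟩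
        rcases hci hx with h1 | h1
        · exact absurd h1.1 hx'
        · exact h1
      apply hg.2.2.2
      refine down i _ hiI ?_
      intro x hx
      rcases hci hx with h2 | h2
      · refine absurd ?_ h2.2
        rw [← inf_eq_left.2 h1, hi] at hx
        exact hx.2
      · exact h2
  have uniq : ∀ (p : Set X) (b b' : B), h b \ p ∈ I → p \ h b' ∈ I → b ≤ b' := by
    intro p b b' h1 h2
    apply low
    refine down _ _ (un _ _ h1 h2) ?_
    rintro x ⟨hx, hx'⟩
    by_cases hxp : x ∈ p
    · exact Or.inr ⟨hxp, hx'⟩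
    · exact Or.inl ⟨hx, hxp⟩
  choose r hr1 hr2 using key
  have eq : ∀ (p : Set X) (b : B), h b \ p ∈ I → p \ h b ∈ I → r p = b := by
    intro p b h1 h2
    exact le_antisymm (uniq p _ _ (hr1 p) h2) (uniq p _ _ h1 (hr2 p))
  refine ⟨r, ?_, ?_, ?_⟩
  · intro p
    apply eq
    · refine down _ _ (hr2 p) ?_
      rintro x ⟨hx, hx'⟩
      rw [hc] at hx
      exact ⟨not_not.1 hx', hx⟩
    · refine down _ _ (hr1 p) ?_
      rintro x ⟨hx, hx'⟩
      rw [hc] at hx'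
      exact ⟨not_not.1 hx', hx⟩
  · intro p q
    apply eq
    · refine down _ _ (un _ _ (hr1 p) (hr1 q)) ?_
      rintro x ⟨hx, hx'⟩
      rw [hi] at hx
      by_cases hxp : x ∈ p
      · exact Or.inr ⟨hx.2, fun hq => hx' ⟨hxp, hq⟩⟩
      · exact Or.inl ⟨hx.1, hxp⟩
    · refine down _ _ (un _ _ (hr2 p) (hr2 q)) ?_
      rintro x ⟨hx, hx'⟩
      rw [hi] at hx'
      by_cases hxp : x ∈ h (r p)
      · exact Or.inr ⟨hx.2, fun hq => hx' ⟨hxp, hq⟩⟩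
      · exact Or.inl ⟨hx.1, hxp⟩
  · intro b
    apply eq
    · rw [Set.sdiff_self]
      exact hg.1
    · rw [Set.sdiff_self]
      exact hg.1

theorem exists_ultrafilter {b : B} (hb : b ≠ ⊥) : ∃ U : Set B, IsBUltrafilter U ∧ b ∈ U := by
  obtain ⟨J, hJ, -, hd⟩ := DistribLattice.prime_ideal_of_disjoint_filter_ideal
    (F := Order.PFilter.principal b) (I := Order.Ideal.principal (⊥ : B)) (by
      rw [Set.disjoint_left]
      intro x hx hx'
      have h1 : b ≤ x := Order.PFilter.mem_principal.1 hx
      have h2 : x = ⊥ := le_bot_iff.1 (Order.Ideal.mem_principal.1 hx')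
      exact hb (le_bot_iff.1 (h2 ▸ h1)))
  have hbJ : b ∉ J := Set.disjoint_left.1 hd (Order.PFilter.mem_principal.2 le_rfl)
  refine ⟨{x | x ∉ J}, ⟨⟨?_, ?_, ?_, ?_⟩, ?_⟩, hbJ⟩
  · exact fun ht => hbJ (J.lower le_top ht)
  · exact fun h => h J.bot_mem
  · exact fun a c ha hac hc => ha (J.lower hac hc)
  · exact fun a c ha hc hac => (hJ.mem_or_mem hac).elim ha hc
  · intro a
    by_contra hcon
    simp only [Set.mem_ofPred_eq, not_or, not_not] at hcon
    have := J.sup_mem hcon.1 hcon.2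
    rw [sup_compl_eq_top] at this
    exact hbJ (J.lower le_top this)

theorem ultra_compl {U : Set B} (hU : IsBUltrafilter U) (a : B) : aᶜ ∈ U ↔ a ∉ U := by
  constructor
  · intro h1 h2
    have := hU.1.2.2.2 _ _ h2 h1
    rw [inf_compl_self] at this
    exact hU.1.2.1 this
  · intro h1
    exact (hU.2 a).resolve_left h1

theorem ultra_inf {U : Set B} (hU : IsBUltrafilter U) (a b : B) :
    a ⊓ b ∈ U ↔ a ∈ U ∧ b ∈ U :=
  ⟨fun h => ⟨hU.1.2.2.1 _ _ h inf_le_left, hU.1.2.2.1 _ _ h inf_le_right⟩,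
    fun h => hU.1.2.2.2 _ _ h.1 h.2⟩

/-- The type of ultrafilters on `B`. -/
def Ult (B : Type) [CompleteBooleanAlgebra B] : Type := {U : Set B // IsBUltrafilter U}

/-- The power set of the Stone space retracts onto the complete algebra `B`. -/
theorem exists_stone_retract : ∃ r : Set (Ult B) → B, (∀ p, r pᶜ = (r p)ᶜ) ∧
    (∀ p q, r (p ∩ q) = r p ⊓ r q) ∧ ∀ b, r {U | b ∈ U.1} = b := by
  apply exists_retract (fun b => {U : Ult B | b ∈ U.1})
  · intro b hb
    by_contra hb0
    obtain ⟨U, hU, hbU⟩ := exists_ultrafilter hb0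
    have : (⟨U, hU⟩ : Ult B) ∈ {U : Ult B | b ∈ U.1} := hbU
    rw [hb] at this
    exact this
  · intro b
    ext U
    exact ultra_compl U.2 b
  · intro a b
    ext U
    exact ultra_inf U.2 a b

end Retract

/-! ### Basic facts on Boolean-valued evaluations -/

section Logic

variable {B : Type} [CompleteBooleanAlgebra B] {L : FirstOrder.Language.{0, 0}} {C D : Type}

/-- The propositional part of the axioms of a Boolean-valued structure. -/
def Pre (val : L.Formula C → B) : Prop :=
  (∀ φ : L.Formula C,
      (∀ (N : Type) [L.Structure N] [Nonempty N] (v : C → N), φ.Realize v) → val φ = ⊤) ∧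
  (∀ φ : L.Formula C, val φ.not = (val φ)ᶜ) ∧
  (∀ φ ψ : L.Formula C, val (φ ⊓ ψ) = val φ ⊓ val ψ)

theorem _root_.BVal.IsBVal.pre {val : L.Formula C → B} (h : IsBVal val) : Pre val :=
  ⟨h.1, h.2.1, h.2.2.1⟩

theorem Pre.mono {val : L.Formula C → B} (h : Pre val) {φ ψ : L.Formula C}
    (hv : ∀ (N : Type) [L.Structure N] [Nonempty N] (v : C → N), φ.Realize v → ψ.Realize v) :
    val φ ≤ val ψ := by
  have h1 : val (φ ⊓ ψ.not).not = ⊤ := by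
    apply h.1
    intro N _ _ v
    rw [Formula.realize_not, Formula.realize_inf, Formula.realize_not]
    intro hh
    exact hh.2 (hv N v hh.1)
  rw [h.2.1, h.2.2, h.2.1, compl_eq_top] at h1
  rwa [← sdiff_eq_bot_iff, sdiff_eq]

theorem Pre.congr {val : L.Formula C → B} (h : Pre val) {φ ψ : L.Formula C}
    (hv : ∀ (N : Type) [L.Structure N] [Nonempty N] (v : C → N), φ.Realize v ↔ ψ.Realize v) :
    val φ = val ψ :=
  le_antisymm (h.mono fun N _ _ v => (hv N v).1) (h.mono fun N _ _ v => (hv N v).2)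

theorem Pre.comp {val : L.Formula D → B} (h : Pre val) (f : C → D) :
    Pre (fun φ : L.Formula C => val (φ.relabel f)) := by
  refine ⟨?_, ?_, ?_⟩
  · intro φ hφ
    apply h.1
    intro N _ _ v
    rw [Formula.realize_relabel]
    exact hφ N _
  · intro φ
    rw [← h.2.1]
    apply h.congr
    intro N _ _ v
    simp only [Formula.realize_relabel, Formula.realize_not]
  · intro φ ψ
    rw [← h.2.2]
    apply h.congr
    intro N _ _ v
    simp only [Formula.realize_relabel, Formula.realize_inf]

theorem realize_plug {N : Type} [L.Structure N] {k : ℕ} (φ : L.BoundedFormula C k)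
    (b : Fin k → C) (v : C → N) : (plug φ b).Realize v ↔ φ.Realize v (v ∘ b) := by
  unfold plug plugEmb
  rw [Formula.realize_relabel, BoundedFormula.realize_toFormula]
  rfl

theorem realize_ex_one {N : Type} [L.Structure N] (φ : L.BoundedFormula C 1) (v : C → N) :
    Formula.Realize φ.ex v ↔ ∃ a : N, φ.Realize v (fun _ => a) := by
  unfold Formula.Realize
  rw [BoundedFormula.realize_ex]
  have : ∀ a : N, (Fin.snoc default a : Fin 1 → N) = fun _ => a := by
    intro a
    funext i
    have hi : i = Fin.last 0 := Fin.ext (by omega)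
    rw [hi, Fin.snoc_last]
  simp only [this]

theorem isBVal_of {val : L.Formula C → B} (h : Pre val) (hf : IsFull val)
    (hne : ∀ a b : C, a ≠ b → val (Term.equal (Term.var a) (Term.var b)) < ⊤) : IsBVal val := by
  refine ⟨h.1, h.2.1, h.2.2, ?_, hne⟩
  intro φ
  apply le_antisymm
  · obtain ⟨a, ha⟩ := hf φ
    rw [ha]
    exact le_iSup (fun a : C => val (plug φ fun _ => a)) a
  · apply iSup_le
    intro a
    apply h.mono
    intro N _ _ v hv
    rw [realize_plug] at hv
    exact (realize_ex_one φ v).2 ⟨v a, hv⟩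

theorem realize_listConj {N : Type} [L.Structure N] (l : List (L.Formula C)) (v : C → N) :
    Formula.Realize (listConj l) v ↔ ∀ φ ∈ l, Formula.Realize φ v := by
  induction l with
  | nil => simp [listConj, Formula.Realize]
  | cons φ l ih =>
    rw [listConj, Formula.realize_inf, ih]
    simp

theorem Pre.listConj_mem {val : L.Formula C → B} (h : Pre val) {U : Set B}
    (hU : IsBUltrafilter U) (l : List (L.Formula C)) (hl : ∀ φ ∈ l, val φ ∈ U) :
    val (listConj l) ∈ U := by
  induction l with
  | nil =>
    have : val (listConj []) = ⊤ := by
      apply h.1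
      intro N _ _ v
      rw [realize_listConj]
      simp
    rw [this]
    exact hU.1.1
  | cons φ l ih =>
    have : val (listConj (φ :: l)) = val φ ⊓ val (listConj l) := h.2.2 _ _
    rw [this]
    exact hU.1.2.2.2 _ _ (hl φ (by simp)) (ih fun ψ hψ => hl ψ (by simp [hψ]))

theorem Pre.exists_realize {val : L.Formula C → B} (h : Pre val) {φ : L.Formula C}
    (hφ : val φ ≠ ⊥) :
    ∃ (N : Type) (_ : L.Structure N) (_ : Nonempty N) (v : C → N), φ.Realize v := by
  by_contra hcon
  push Not at hcon
  apply hφ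
  rw [← compl_eq_top, ← h.2.1]
  apply h.1
  intro N _ _ v
  exact hcon N inferInstance inferInstance v

theorem realize_congr {N : Type} [L.Structure N] [DecidableEq C] (φ : L.Formula C) (v w : C → N)
    (h : ∀ c ∈ φ.freeVarFinset, v c = w c) : φ.Realize v ↔ φ.Realize w := by
  have h1 := BoundedFormula.realize_restrictFreeVar (φ := φ) (f := Subtype.val) (v := v)
    (xs := (default : Fin 0 → N)) v (fun _ => rfl)
  have h2 := BoundedFormula.realize_restrictFreeVar (φ := φ) (f := Subtype.val) (v := v)
    (xs := (default : Fin 0 → N)) w (fun a => h a a.2)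
  exact h1.symm.trans h2

/-- Compactness for sets of formulas. -/
theorem compactness (Γ : Set (L.Formula C))
    (h : ∀ l : List (L.Formula C), (∀ φ ∈ l, φ ∈ Γ) →
      ∃ (N : Type) (_ : L.Structure N) (_ : Nonempty N) (v : C → N), ∀ φ ∈ l, φ.Realize v) :
    ∃ (N : Type) (_ : L.Structure N) (_ : Nonempty N) (v : C → N), ∀ φ ∈ Γ, φ.Realize v := by
  have hsat : Theory.IsSatisfiable
      ((Formula.equivSentence '' Γ : Set (L[[C]].Sentence)) : L[[C]].Theory) := by
    rw [Theory.isSatisfiable_iff_isFinitelySatisfiable]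
    intro T0 hT0
    obtain ⟨N, _, _, v, hv⟩ := h (T0.toList.map Formula.equivSentence.symm) (by
      intro φ hφ
      rw [List.mem_map] at hφ
      obtain ⟨σ, hσ, rfl⟩ := hφ
      obtain ⟨ψ, hψ, rfl⟩ := hT0 (Finset.mem_toList.1 hσ)
      simpa using hψ)
    let := constantsOn.structure v
    have _i2 : N ⊨ (T0 : L[[C]].Theory) := by
      rw [Theory.model_iff]
      intro σ hσ
      exact (Formula.realize_equivSentence_symm N σ v).1
        (hv _ (List.mem_map_of_mem (Finset.mem_toList.2 hσ)))
    exact Theory.Model.isSatisfiable N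
  obtain ⟨M⟩ := hsat
  let _i1 : L.Structure M := (L.lhomWithConstants C).reduct M
  have _i2 : (L.lhomWithConstants C).IsExpansionOn M := LHom.isExpansionOn_reduct _ _
  refine ⟨M, inferInstance, inferInstance, fun a => (L.con a : M), ?_⟩
  intro φ hφ
  rw [← Formula.realize_equivSentence]
  exact Theory.realize_sentence_of_mem _ (Set.mem_image_of_mem _ hφ)

/-- Any evaluation and ultrafilter has an ordinary model of the induced complete type. -/
theorem Pre.exists_model {val : L.Formula C → B} (h : Pre val) {U : Set B}
    (hU : IsBUltrafilter U) :
    ∃ (N : Type) (_ : L.Structure N) (_ : Nonempty N) (v : C → N),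
      ∀ φ : L.Formula C, val φ ∈ U ↔ φ.Realize v := by
  obtain ⟨N, i1, i2, v, hv⟩ := compactness {φ | val φ ∈ U} (by
    intro l hl
    have := h.listConj_mem hU l hl
    obtain ⟨N, i1, i2, v, hv⟩ := h.exists_realize (φ := listConj l) (by
      intro h0
      rw [h0] at this
      exact hU.1.2.1 this)
    exact ⟨N, i1, i2, v, (realize_listConj l v).1 hv⟩)
  refine ⟨N, i1, i2, v, fun φ => ⟨fun hφ => hv φ hφ, ?_⟩⟩
  intro hφ
  by_contra hn
  rw [← ultra_compl hU, ← h.2.1] at hn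
  exact hv _ hn hφ

/-- Evaluations of sentences are determined by a theory. -/
theorem Pre.eq_top_of_models {val : L.Formula C → B} (h : Pre val) {T : L.Theory}
    (hT : BModels val T) {σ : L.Sentence} (hσ : T ⊨ᵇ σ) :
    val (Formula.relabel (fun e : Empty => e.elim) σ) = ⊤ := by
  by_contra hne
  have hne' : (val (Formula.relabel (fun e : Empty => e.elim) σ))ᶜ ≠ ⊥ := by
    rwa [Ne, compl_eq_bot]
  obtain ⟨U, hU, hmem⟩ := exists_ultrafilter hne'
  obtain ⟨N, _, _, v, hv⟩ := h.exists_model hU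
  have key : ∀ τ : L.Sentence,
      val (Formula.relabel (fun e : Empty => e.elim) τ) ∈ U ↔ N ⊨ τ := by
    intro τ
    rw [hv, Formula.realize_relabel, Sentence.Realize]
    rw [Subsingleton.elim (v ∘ fun e : Empty => e.elim) default]
  have _i2 : N ⊨ T := by
    rw [Theory.model_iff]
    intro τ hτ
    rw [← key, hT τ hτ]
    exact hU.1.1
  rw [ultra_compl hU] at hmem
  exact hmem ((key σ).2 (hσ.realize_sentence N))

end Logic

/-! ### Downward Löwenheim–Skolem -/

section DLS

variable {B : Type} [CompleteBooleanAlgebra B] {L : FirstOrder.Language.{0, 0}} {C : Type}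

/-- The language whose function symbols are names for witness functions. -/
def witLang (L : FirstOrder.Language.{0, 0}) : FirstOrder.Language.{0, 0} :=
  ⟨fun n => L.Formula (Fin n ⊕ Fin 1), fun _ => Empty⟩

theorem countable_formula (hL : L.card ≤ ℵ₀) {α : Type} [Countable α] :
    Countable (L.Formula α) := by
  have h1 : Countable (Σ n, L.BoundedFormula α n) := by
    rw [← Cardinal.mk_le_aleph0_iff]
    refine BoundedFormula.card_le.trans ?_
    simp only [Cardinal.lift_id]
    exact max_le le_rfl (Cardinal.add_le_aleph0.2 ⟨Cardinal.mk_le_aleph0_iff.2 inferInstance, hL⟩)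
  exact Function.Injective.countable (f := fun φ : L.Formula α =>
    (⟨0, φ⟩ : Σ n, L.BoundedFormula α n)) (fun φ ψ h => by simpa using h)

theorem countable_witLang (hL : L.card ≤ ℵ₀) : Countable (Σ n, (witLang L).Functions n) := by
  have : ∀ n, Countable ((witLang L).Functions n) := fun n =>
    countable_formula (L := L) hL (α := Fin n ⊕ Fin 1)
  infer_instance

theorem exists_witness {val : L.Formula C → B} (h : Pre val) (hf : IsFull val) {n : ℕ}
    (θ : L.Formula (Fin n ⊕ Fin 1)) (c : Fin n → C) :
    ∃ a : C, ∀ a' : C, val (θ.relabel (Sum.elim c fun _ => a')) ≤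
      val (θ.relabel (Sum.elim c fun _ => a)) := by
  let φ : L.BoundedFormula C 1 :=
    BoundedFormula.relabel (Sum.elim (fun i => Sum.inl (c i)) (fun i : Fin 1 => Sum.inr i)) θ
  have hφ : ∀ (N : Type) [L.Structure N] (v : C → N) (x : N),
      φ.Realize v (fun _ => x) ↔ θ.Realize (Sum.elim (v ∘ c) fun _ => x) := by
    intro N _ v x
    have := BoundedFormula.realize_relabel (φ := θ) (v := v) (xs := fun _ : Fin (1 + 0) => x)
      (g := (Sum.elim (fun i => Sum.inl (c i)) (fun i : Fin 1 => Sum.inr i)))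
    refine this.trans ?_
    unfold Formula.Realize
    rw [Subsingleton.elim ((fun _ : Fin (1 + 0) => x) ∘ Fin.natAdd 1) default]
    have e : (Sum.elim v ((fun _ : Fin (1 + 0) => x) ∘ Fin.castAdd 0) ∘
        Sum.elim (fun i => Sum.inl (c i)) fun i : Fin 1 => Sum.inr i) =
        Sum.elim (v ∘ c) fun _ => x := by
      funext i
      rcases i with i | i <;> rfl
    rw [e]
  have hr : ∀ (N : Type) [L.Structure N] (v : C → N) (x : C),
      (θ.relabel (Sum.elim c fun _ => x)).Realize v ↔
        θ.Realize (Sum.elim (v ∘ c) fun _ => v x) := by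
    intro N _ v x
    rw [Formula.realize_relabel]
    have e : v ∘ Sum.elim c (fun _ : Fin 1 => x) = Sum.elim (v ∘ c) fun _ => v x := by
      funext i
      rcases i with i | i <;> rfl
    rw [e]
  obtain ⟨a, ha⟩ := hf φ
  refine ⟨a, fun a' => ?_⟩
  calc val (θ.relabel (Sum.elim c fun _ => a')) ≤ val φ.ex := by
        apply h.mono
        intro N _ _ v hv
        rw [hr] at hv
        exact (realize_ex_one φ v).2 ⟨v a', (hφ N v _).2 hv⟩
    _ = val (plug φ fun _ => a) := ha
    _ ≤ _ := by
        apply h.mono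
        intro N _ _ v hv
        rw [realize_plug] at hv
        rw [hr]
        exact (hφ N v _).1 hv

theorem finite_params {α : Type} (φ : L.BoundedFormula α 1) :
    ∃ (n : ℕ) (θ : L.Formula (Fin n ⊕ Fin 1)) (c : Fin n → α),
      ∀ (N : Type) [L.Structure N] (v : α → N) (x : N),
        θ.Realize (Sum.elim (v ∘ c) fun _ => x) ↔ φ.Realize v (fun _ => x) := by
  classical
  let e := φ.freeVarFinset.equivFin
  refine ⟨_, (φ.restrictFreeVar e).toFormula, fun i => (e.symm i).1, ?_⟩
  intro N _ v x
  rw [BoundedFormula.realize_toFormula]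
  apply BoundedFormula.realize_restrictFreeVar
  intro a
  simp

theorem dls (hL : L.card ≤ ℵ₀) {T : L.Theory} {val : L.Formula C → B}
    (hM : IsFullBModel T val) (X : Set C) :
    ∃ S : Set C, X ⊆ S ∧ Cardinal.mk ↥S ≤ Cardinal.mk ↥X + ℵ₀ ∧
      IsFullBModel T fun φ : L.Formula ↥S => val (φ.relabel Subtype.val) := by
  obtain ⟨hB, hf, hT⟩ := hM
  have hp := hB.pre
  choose wit hwit using fun (n : ℕ) (θ : L.Formula (Fin n ⊕ Fin 1)) (c : Fin n → C) =>
    exists_witness hp hf θ c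
  let _i : (witLang L).Structure C := ⟨fun {n} θ c => wit n θ c, fun r => r.elim⟩
  let S := Substructure.closure (witLang L) X
  have hpS := hp.comp (Subtype.val : ↥(S : Set C) → C)
  have hfS : IsFull fun φ : L.Formula ↥(S : Set C) => val (φ.relabel Subtype.val) := by
    intro φ
    obtain ⟨n, θ, c, hθ⟩ := finite_params φ
    have hmem : wit n θ (fun i => (c i : C)) ∈ S :=
      S.fun_mem (L := witLang L) (n := n) θ (fun i => (c i : C)) (fun i => (c i).2)
    refine ⟨⟨_, hmem⟩, ?_⟩
    apply le_antisymm
    · let φC : L.BoundedFormula C 1 := φ.subst fun s => Term.var (s : C)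
      have hφC : ∀ (N : Type) [L.Structure N] (v : C → N) (x : N),
          φC.Realize v (fun _ => x) ↔ φ.Realize (fun s => v s) (fun _ => x) := by
        intro N _ v x
        exact BoundedFormula.realize_subst
      obtain ⟨a, ha⟩ := hf φC
      calc val (Formula.relabel Subtype.val φ.ex) ≤ val φC.ex := by
            apply hp.mono
            intro N _ _ v hv
            rw [Formula.realize_relabel, realize_ex_one] at hv
            obtain ⟨x, hx⟩ := hv
            exact (realize_ex_one φC v).2 ⟨x, (hφC N v x).2 hx⟩
        _ = val (plug φC fun _ => a) := ha
        _ ≤ val (θ.relabel (Sum.elim (fun i => (c i : C)) fun _ => a)) := by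
            apply hp.mono
            intro N _ _ v hv
            rw [realize_plug] at hv
            have hv' := (hθ N (fun s => v s) (v a)).2 ((hφC N v (v a)).1 hv)
            rw [Formula.realize_relabel]
            convert hv' using 1
            funext i
            rcases i with i | i <;> rfl
        _ ≤ val (θ.relabel (Sum.elim (fun i => (c i : C))
              fun _ => wit n θ (fun i => (c i : C)))) := hwit n θ _ a
        _ ≤ _ := by
            apply hp.mono
            intro N _ _ v hv
            rw [Formula.realize_relabel] at hv
            rw [Formula.realize_relabel, realize_plug]
            apply (hθ N (v ∘ Subtype.val) (v (wit n θ (fun i => (c i : C))))).1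
            convert hv using 1
            funext i
            rcases i with i | i <;> rfl
    · apply hpS.mono
      intro N _ _ v hv
      rw [realize_plug] at hv
      exact (realize_ex_one φ v).2 ⟨_, hv⟩
  refine ⟨S, Substructure.subset_closure, ?_, isBVal_of hpS hfS ?_, hfS, ?_⟩
  · have h1 := Substructure.lift_card_closure_le (L := witLang L) (s := X)
    simp only [Cardinal.lift_id] at h1
    refine h1.trans (max_le le_add_self ?_)
    have := Cardinal.mk_le_aleph0_iff.2 (countable_witLang hL)
    gcongr
  · intro a b hab
    have h1 := hB.2.2.2.2 (a : C) b (fun h => hab (Subtype.ext h))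
    refine lt_of_eq_of_lt ?_ h1
    apply hp.congr
    intro N _ _ v
    simp [Formula.realize_relabel, Formula.realize_equal]
  · intro σ hσ
    rw [← hT σ hσ]
    apply hp.congr
    intro N _ _ v
    rw [Formula.realize_relabel, Formula.realize_relabel, Formula.realize_relabel]
    rw [Subsingleton.elim ((v ∘ Subtype.val) ∘ fun e : Empty => e.elim)
      (v ∘ fun e : Empty => e.elim)]

end DLS

/-! ### Amalgamation -/

section Amalgamation

variable {B : Type} [CompleteBooleanAlgebra B] {L : FirstOrder.Language.{0, 0}} {C C0 C1 : Type}

theorem exists_over {v0 : L.Formula C0 → B} {v1 : L.Formula C1 → B}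
    (h1 : Pre v1) {e0 : C → C0} {e1 : C → C1} (he1 : Function.Injective e1)
    (hag : ∀ φ : L.Formula C, v0 (φ.relabel e0) = v1 (φ.relabel e1)) {U : Set B}
    (hU : IsBUltrafilter U) {N : Type} [L.Structure N] [Nonempty N] {g0 : C0 → N}
    (hg0 : ∀ φ : L.Formula C0, v0 φ ∈ U ↔ φ.Realize g0) {ψ : L.Formula C1} (hψ : v1 ψ ∈ U) :
    ∃ g1 : C1 → N, (∀ c, g0 (e0 c) = g1 (e1 c)) ∧ ψ.Realize g1 := by
  classical
  let F := {d : C1 // d ∈ ψ.freeVarFinset}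
  let ρ : F → C ⊕ F := fun d =>
    if h : ∃ c, e1 c = d.1 then Sum.inl h.choose else Sum.inr d
  let ψ' : L.Formula (C ⊕ F) := BoundedFormula.restrictFreeVar ψ ρ
  let χ : L.Formula C := ψ'.iExs F
  have hχ : v1 (χ.relabel e1) ∈ U := by
    refine hU.1.2.2.1 _ _ hψ (h1.mono ?_)
    intro M _ _ w hw
    rw [Formula.realize_relabel, Formula.realize_iExs]
    refine ⟨fun d => w d.1, ?_⟩
    refine (BoundedFormula.realize_restrictFreeVar (φ := ψ) (f := ρ) w ?_).2 hw
    intro d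
    by_cases h : ∃ c, e1 c = d.1
    · have : ρ d = Sum.inl h.choose := dif_pos h
      rw [this, Sum.elim_inl, Function.comp_apply, h.choose_spec]
    · have : ρ d = Sum.inr d := dif_neg h
      rw [this, Sum.elim_inr]
  rw [← hag, hg0, Formula.realize_relabel, Formula.realize_iExs] at hχ
  obtain ⟨i, hi⟩ := hχ
  let g1 : C1 → N := fun d =>
    if h : ∃ c, e1 c = d then g0 (e0 h.choose)
    else if h' : d ∈ ψ.freeVarFinset then i ⟨d, h'⟩ else Classical.arbitrary N
  refine ⟨g1, ?_, ?_⟩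
  · intro c
    have h : ∃ c', e1 c' = e1 c := ⟨c, rfl⟩
    have h2 : g1 (e1 c) = g0 (e0 h.choose) := dif_pos h
    rw [h2, he1 h.choose_spec]
  · refine (BoundedFormula.realize_restrictFreeVar (φ := ψ) (f := ρ) g1 ?_).1 hi
    intro d
    by_cases h : ∃ c, e1 c = d.1
    · have h3 : ρ d = Sum.inl h.choose := dif_pos h
      have h2 : g1 d.1 = g0 (e0 h.choose) := dif_pos h
      rw [h3, h2]
      rfl
    · have h3 : ρ d = Sum.inr d := dif_neg h
      have h2 : g1 d.1 = i d := (dif_neg h).trans (dif_pos d.2)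
      rw [h3, h2]
      rfl

/-- Amalgamation of ordinary specializations at one ultrafilter. -/
theorem exists_fiber {v0 : L.Formula C0 → B} {v1 : L.Formula C1 → B} (h0 : Pre v0)
    (h1 : Pre v1) {e0 : C → C0} {e1 : C → C1} (he1 : Function.Injective e1)
    (hag : ∀ φ : L.Formula C, v0 (φ.relabel e0) = v1 (φ.relabel e1)) {U : Set B}
    (hU : IsBUltrafilter U) :
    ∃ (N : OrdStructure L) (g0 : C0 → N) (g1 : C1 → N),
      (∀ φ : L.Formula C0, v0 φ ∈ U ↔ φ.Realize g0) ∧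
      (∀ φ : L.Formula C1, v1 φ ∈ U ↔ φ.Realize g1) ∧ ∀ c, g0 (e0 c) = g1 (e1 c) := by
  classical
  obtain ⟨N0, _, _, k0, hk0⟩ := h0.exists_model hU
  let Γ : Set (L.Formula (C0 ⊕ C1)) :=
    {χ | (∃ φ, v0 φ ∈ U ∧ φ.relabel Sum.inl = χ) ∨ (∃ ψ, v1 ψ ∈ U ∧ ψ.relabel Sum.inr = χ) ∨
      ∃ c, Term.equal (Term.var (Sum.inl (e0 c))) (Term.var (Sum.inr (e1 c))) = χ}
  obtain ⟨N, i1, i2, g, hg⟩ := compactness Γ (by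
    intro l hl
    let sel : L.Formula (C0 ⊕ C1) → L.Formula C1 := fun χ =>
      if h : ∃ ψ, v1 ψ ∈ U ∧ ψ.relabel Sum.inr = χ then h.choose else listConj []
    have hsel : v1 (listConj (l.map sel)) ∈ U := by
      apply h1.listConj_mem hU
      intro φ hφ
      obtain ⟨χ, hχ, rfl⟩ := List.mem_map.1 hφ
      by_cases h : ∃ ψ, v1 ψ ∈ U ∧ ψ.relabel Sum.inr = χ
      · have : sel χ = h.choose := dif_pos h
        rw [this]
        exact h.choose_spec.1
      · have : sel χ = listConj [] := dif_neg h
        rw [this]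
        exact h1.listConj_mem hU [] (by simp)
    obtain ⟨k1, hk, hk1⟩ := exists_over h1 he1 hag hU hk0 hsel
    rw [realize_listConj] at hk1
    refine ⟨N0, inferInstance, inferInstance, Sum.elim k0 k1, ?_⟩
    intro χ hχ
    rcases hl χ hχ with ⟨φ, hφ, rfl⟩ | h | ⟨c, rfl⟩
    · rw [Formula.realize_relabel, Sum.elim_comp_inl, ← hk0]
      exact hφ
    · have h2 : sel χ = h.choose := dif_pos h
      have h3 := hk1 (sel χ) (List.mem_map_of_mem hχ)
      rw [h2] at h3
      rw [← h.choose_spec.2, Formula.realize_relabel, Sum.elim_comp_inr]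
      exact h3
    · rw [Formula.realize_equal]
      exact hk c)
  have hg0 : ∀ φ : L.Formula C0, v0 φ ∈ U → φ.Realize (g ∘ Sum.inl) := fun φ hφ =>
    Formula.realize_relabel.1 (hg _ (Or.inl ⟨φ, hφ, rfl⟩))
  have hg1 : ∀ φ : L.Formula C1, v1 φ ∈ U → φ.Realize (g ∘ Sum.inr) := fun φ hφ =>
    Formula.realize_relabel.1 (hg _ (Or.inr (Or.inl ⟨φ, hφ, rfl⟩)))
  refine ⟨⟨N⟩, g ∘ Sum.inl, g ∘ Sum.inr, ?_, ?_, ?_⟩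
  · refine fun φ => ⟨hg0 φ, fun hφ => ?_⟩
    by_contra hn
    rw [← ultra_compl hU, ← h0.2.1] at hn
    exact hg0 _ hn hφ
  · refine fun φ => ⟨hg1 φ, fun hφ => ?_⟩
    by_contra hn
    rw [← ultra_compl hU, ← h1.2.1] at hn
    exact hg1 _ hn hφ
  · intro c
    have := hg _ (Or.inr (Or.inr ⟨c, rfl⟩))
    rw [Formula.realize_equal] at this
    exact this

/-- The evaluation on a product of ordinary structures induced by `r`. -/
def prodVal {X : Type} (r : Set X → B) (N : X → OrdStructure L) :
    L.Formula (∀ x, N x) → B :=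
  fun φ => r {x | φ.Realize fun a => a x}

theorem prodVal_pre {X : Type} {r : Set X → B} (hc : ∀ p, r pᶜ = (r p)ᶜ)
    (hi : ∀ p q, r (p ∩ q) = r p ⊓ r q) (N : X → OrdStructure L) : Pre (prodVal r N) := by
  have hu : r Set.univ = ⊤ := by
    have h1 := hi Set.univ Set.univᶜ
    rw [Set.inter_compl_self, hc, inf_compl_self] at h1
    have h2 := hc ∅
    rw [h1, Set.compl_empty, compl_bot] at h2
    exact h2
  refine ⟨?_, ?_, ?_⟩
  · intro φ hφ
    rw [← hu]
    unfold prodVal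
    congr 1
    ext x
    exact ⟨fun _ => trivial, fun _ => hφ (N x) _⟩
  · intro φ
    unfold prodVal
    rw [← hc]
    rfl
  · intro φ ψ
    unfold prodVal
    rw [← hi]
    congr 1
    ext x
    exact Formula.realize_inf

theorem prodVal_full {X : Type} (r : Set X → B) (N : X → OrdStructure L) :
    IsFull (prodVal r N) := by
  classical
  intro φ
  let a : ∀ x, N x := fun x =>
    if h : ∃ y : N x, φ.Realize (fun b : (∀ x, N x) => b x) (fun _ => y) then h.choose
    else Classical.arbitrary (N x)
  refine ⟨a, ?_⟩
  unfold prodVal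
  congr 1
  ext x
  have e1 := realize_ex_one φ (fun b : (∀ x, N x) => b x)
  have e2 := realize_plug φ (fun _ => a) (fun b : (∀ x, N x) => b x)
  refine e1.trans (Iff.trans ?_ e2.symm)
  constructor
  · intro h
    have h1 : a x = h.choose := dif_pos h
    have h2 := h.choose_spec
    rw [← h1] at h2
    exact h2
  · intro h
    exact ⟨a x, h⟩

/-- Value of a formula is unchanged when parameters are replaced by equal ones. -/
theorem Pre.relabel_congr {D E : Type} {w : L.Formula D → B} (h : Pre w) {f g : E → D}
    (hfg : ∀ c, w (Term.equal (Term.var (f c)) (Term.var (g c))) = ⊤) (φ : L.Formula E) :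
    w (φ.relabel f) = w (φ.relabel g) := by
  classical
  have hl : ∀ l : List E, w (listConj (l.map fun c =>
      (Term.equal (Term.var (f c)) (Term.var (g c)) : L.Formula D))) = ⊤ := by
    intro l
    induction l with
    | nil =>
      apply h.1
      intro N _ _ v
      rw [realize_listConj]
      simp
    | cons c l ih =>
      rw [List.map_cons]
      refine (h.2.2 _ _).trans ?_
      rw [ih, hfg, inf_top_eq]
  have main : ∀ (f g : E → D) (χ : L.Formula D), w χ = ⊤ →
      (∀ (N : Type) [L.Structure N] (v : D → N), χ.Realize v →
        ∀ c ∈ φ.freeVarFinset, v (f c) = v (g c)) →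
      w (φ.relabel f) ≤ w (φ.relabel g) := by
    intro f g χ hχ hv
    have : w (φ.relabel f) = w (φ.relabel f ⊓ χ) := by
      rw [h.2.2, hχ, inf_top_eq]
    rw [this]
    apply h.mono
    intro N _ _ v hh
    rw [Formula.realize_inf, Formula.realize_relabel] at hh
    rw [Formula.realize_relabel]
    exact (realize_congr φ _ _ (hv N v hh.2)).1 hh.1
  have hag : ∀ (N : Type) [L.Structure N] (v : D → N),
      Formula.Realize (listConj (φ.freeVarFinset.toList.map fun c =>
        (Term.equal (Term.var (f c)) (Term.var (g c)) : L.Formula D))) v →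
      ∀ c ∈ φ.freeVarFinset, v (f c) = v (g c) := by
    intro N _ v hv c hc
    rw [realize_listConj] at hv
    have := hv _ (List.mem_map_of_mem (Finset.mem_toList.2 hc))
    rw [Formula.realize_equal] at this
    exact this
  apply le_antisymm
  · exact main f g _ (hl φ.freeVarFinset.toList) hag
  · exact main g f _ (hl φ.freeVarFinset.toList) (fun N _ v hv c hc => (hag N v hv c hc).symm)

/-- Quotient by equality of value `⊤`. -/
theorem exists_quotient {D : Type} {w : L.Formula D → B} (h : Pre w) (hf : IsFull w) :
    ∃ (E : Type) (u : L.Formula E → B) (q : D → E), IsBVal u ∧ IsFull u ∧ ElemMap w u q := by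
  classical
  have hrefl : ∀ a, w (Term.equal (Term.var a) (Term.var a)) = ⊤ := by
    intro a
    apply h.1
    intro N _ _ v
    rw [Formula.realize_equal]
  have hsymm : ∀ a b, w (Term.equal (Term.var a) (Term.var b)) = ⊤ →
      w (Term.equal (Term.var b) (Term.var a)) = ⊤ := by
    intro a b hab
    rw [← hab]
    apply h.congr
    intro N _ _ v
    rw [Formula.realize_equal, Formula.realize_equal]
    exact eq_comm
  have htrans : ∀ a b c, w (Term.equal (Term.var a) (Term.var b)) = ⊤ →
      w (Term.equal (Term.var b) (Term.var c)) = ⊤ →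
      w (Term.equal (Term.var a) (Term.var c)) = ⊤ := by
    intro a b c hab hbc
    rw [← top_le_iff]
    have : (⊤ : B) = w (Term.equal (Term.var a) (Term.var b) ⊓
        Term.equal (Term.var b) (Term.var c)) := by
      rw [h.2.2, hab, hbc, inf_top_eq]
    rw [this]
    apply h.mono
    intro N _ _ v hv
    rw [Formula.realize_inf, Formula.realize_equal, Formula.realize_equal] at hv
    rw [Formula.realize_equal]
    exact hv.1.trans hv.2
  let s : Setoid D := ⟨fun a b => w (Term.equal (Term.var a) (Term.var b)) = ⊤,
    ⟨hrefl, fun {a b} => hsymm a b, fun {a b c} => htrans a b c⟩⟩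
  let u : L.Formula (Quotient s) → B := fun φ => w (φ.relabel Quotient.out)
  have hu : Pre u := h.comp _
  have hout : ∀ a : D, w (Term.equal (Term.var (Quotient.mk s a).out) (Term.var a)) = ⊤ :=
    fun a => Quotient.mk_out (s := s) a
  have hel : ElemMap w u (Quotient.mk s) := by
    intro φ
    have h1 : u (φ.relabel (Quotient.mk s)) =
        w (φ.relabel fun a => (Quotient.mk s a).out) := by
      apply h.congr
      intro N _ _ v
      rw [Formula.realize_relabel, Formula.realize_relabel, Formula.realize_relabel]
      rfl
    have h2 : w φ = w (φ.relabel id) := by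
      apply h.congr
      intro N _ _ v
      rw [Formula.realize_relabel]
      rfl
    rw [h1, h2]
    exact (h.relabel_congr hout φ).symm
  have huf : IsFull u := by
    intro φ
    let φD : L.BoundedFormula D 1 := φ.subst fun c => Term.var c.out
    obtain ⟨a, ha⟩ := hf φD
    refine ⟨Quotient.mk s a, ?_⟩
    have h1 : u φ.ex = w φD.ex := by
      apply h.congr
      intro N _ _ v
      rw [Formula.realize_relabel, realize_ex_one]
      refine Iff.trans ?_ (realize_ex_one φD v).symm
      refine exists_congr fun x => ?_
      exact (BoundedFormula.realize_subst (φ := φ) (tf := fun c => Term.var c.out) (v := v)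
        (xs := fun _ => x)).symm
    have h2 : u (plug φ fun _ => Quotient.mk s a) =
        w (φ.toFormula.relabel (Sum.elim Quotient.out fun _ => (Quotient.mk s a).out)) := by
      apply h.congr
      intro N _ _ v
      rw [Formula.realize_relabel, realize_plug, Formula.realize_relabel,
        BoundedFormula.realize_toFormula]
      rfl
    have h3 : w (plug φD fun _ => a) =
        w (φ.toFormula.relabel (Sum.elim Quotient.out fun _ => a)) := by
      apply h.congr
      intro N _ _ v
      rw [realize_plug, Formula.realize_relabel, BoundedFormula.realize_toFormula]
      exact BoundedFormula.realize_subst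
    rw [h1, ha, h2, h3]
    apply h.relabel_congr
    rintro (c | c)
    · exact hrefl _
    · exact hsymm _ _ (hout a)
  refine ⟨Quotient s, u, Quotient.mk s, isBVal_of hu huf ?_, huf, hel⟩
  intro a b hab
  rw [lt_top_iff_ne_top]
  intro htop
  apply hab
  have h1 : w (Term.equal (Term.var a.out) (Term.var b.out)) = ⊤ := by
    rw [← htop]
    apply h.congr
    intro N _ _ v
    rw [Formula.realize_relabel, Formula.realize_equal, Formula.realize_equal]
    rfl
  have h2 : a.out ≈ b.out := h1
  rw [← Quotient.out_eq a, ← Quotient.out_eq b]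
  exact Quotient.sound h2

theorem ElemMap.comp_map {D E F : Type} {u : L.Formula D → B} {v : L.Formula E → B}
    {w : L.Formula F → B} (hw : Pre w) {f : D → E} {g : E → F} (hf : ElemMap u v f)
    (hg : ElemMap v w g) : ElemMap u w (g ∘ f) := by
  intro φ
  rw [hf φ, hg]
  apply hw.congr
  intro N _ _ x
  rw [Formula.realize_relabel, Formula.realize_relabel, Formula.realize_relabel]
  rfl

/-- General amalgamation over a common set of parameters. -/
theorem amalgam {T : L.Theory} {v0 : L.Formula C0 → B} {v1 : L.Formula C1 → B}
    (h0 : IsFullBModel T v0) (h1 : IsFullBModel T v1) {e0 : C → C0} {e1 : C → C1}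
    (he1 : Function.Injective e1)
    (hag : ∀ φ : L.Formula C, v0 (φ.relabel e0) = v1 (φ.relabel e1)) :
    ∃ (D : Type) (w : L.Formula D → B), IsFullBModel T w ∧
      ∃ (f0 : C0 → D) (f1 : C1 → D), ElemMap v0 w f0 ∧ ElemMap v1 w f1 ∧
        f0 ∘ e0 = f1 ∘ e1 := by
  obtain ⟨r, hc, hi, hr⟩ := exists_stone_retract (B := B)
  choose N g0 g1 hg0 hg1 hg using fun U : Ult B =>
    exists_fiber h0.1.pre h1.1.pre he1 hag U.2
  have hp := prodVal_pre hc hi N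
  obtain ⟨E, u, q, hu, huf, hq⟩ := exists_quotient hp (prodVal_full r N)
  have k0 : ElemMap v0 (prodVal r N) (fun a U => g0 U a) := by
    intro φ
    unfold prodVal
    conv_lhs => rw [← hr (v0 φ)]
    congr 1
    ext U
    refine (hg0 U φ).trans ?_
    exact (Formula.realize_relabel (φ := φ) (g := fun a U => g0 U a)
      (v := fun a : (∀ U, N U) => a U)).symm
  have k1 : ElemMap v1 (prodVal r N) (fun a U => g1 U a) := by
    intro φ
    unfold prodVal
    conv_lhs => rw [← hr (v1 φ)]
    congr 1
    ext U
    refine (hg1 U φ).trans ?_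
    exact (Formula.realize_relabel (φ := φ) (g := fun a U => g1 U a)
      (v := fun a : (∀ U, N U) => a U)).symm
  have m0 := ElemMap.comp_map hu.pre k0 hq
  have m1 := ElemMap.comp_map hu.pre k1 hq
  refine ⟨E, u, ⟨hu, huf, ?_⟩, _, _, m0, m1, ?_⟩
  · intro σ hσ
    rw [← h0.2.2 σ hσ, m0]
    apply hu.pre.congr
    intro M _ _ v
    rw [Formula.realize_relabel, Formula.realize_relabel, Formula.realize_relabel]
    apply iff_of_eq
    congr 1
    exact Subsingleton.elim _ _
  · funext c
    apply congrArg q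
    funext U
    exact hg U c

theorem injective_of_elem {v : L.Formula C → B} {v1 : L.Formula C1 → B} (h : IsBVal v)
    (h1 : Pre v1) {e1 : C → C1} (he : ElemMap v v1 e1) : Function.Injective e1 := by
  intro a b hab
  by_contra hne
  have h2 := h.2.2.2.2 a b hne
  rw [he] at h2
  apply h2.ne
  apply h1.1
  intro N _ _ x
  rw [Formula.realize_relabel, Formula.realize_equal]
  exact congrArg x hab

theorem agree_sentences {T : L.Theory} (hT : T.IsComplete) {v0 : L.Formula C0 → B}
    {v1 : L.Formula C1 → B} (h0 : IsFullBModel T v0) (h1 : IsFullBModel T v1)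
    (σ : L.Formula Empty) :
    v0 (σ.relabel fun e : Empty => e.elim) = v1 (σ.relabel fun e : Empty => e.elim) := by
  rcases hT.2 σ with h | h
  · rw [h0.1.pre.eq_top_of_models h0.2.2 h, h1.1.pre.eq_top_of_models h1.2.2 h]
  · have k0 := h0.1.pre.eq_top_of_models h0.2.2 h
    have k1 := h1.1.pre.eq_top_of_models h1.2.2 h
    have l0 := (h0.1.pre.comp (fun e : Empty => e.elim)).2.1 σ
    have l1 := (h1.1.pre.comp (fun e : Empty => e.elim)).2.1 σ
    exact compl_injective ((l0.symm.trans k0).trans (l1.symm.trans k1).symm)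

end Amalgamation

end BValAux

open BValAux

/-- **Downward Löwenheim–Skolem, joint embedding, and amalgamation for full
`B`-valued models** (Theorem 3.4). -/
theorem stmt2_dls_jep_ap (B : Type) [CompleteBooleanAlgebra B]
    (L : FirstOrder.Language.{0, 0}) (hL : L.card ≤ ℵ₀)
    (T : L.Theory) (hT : T.IsComplete) :
    -- (1) Downward Löwenheim–Skolem
    (∀ (C : Type) (val : L.Formula C → B), IsFullBModel T val → ∀ X : Set C,
      ∃ S : Set C, X ⊆ S ∧ Cardinal.mk ↥S ≤ Cardinal.mk ↥X + ℵ₀ ∧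
        IsFullBModel T fun φ : L.Formula ↥S => val (φ.relabel Subtype.val)) ∧
    -- (2) Joint Embedding
    (∀ (C0 C1 : Type) (v0 : L.Formula C0 → B) (v1 : L.Formula C1 → B),
      IsFullBModel T v0 → IsFullBModel T v1 →
      ∃ (C : Type) (v : L.Formula C → B), IsFullBModel T v ∧
        ∃ (f0 : C0 → C) (f1 : C1 → C), ElemMap v0 v f0 ∧ ElemMap v1 v f1) ∧
    -- (3) Amalgamation
    (∀ (C C0 C1 : Type) (v : L.Formula C → B) (v0 : L.Formula C0 → B)
        (v1 : L.Formula C1 → B),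
      IsFullBModel T v → IsFullBModel T v0 → IsFullBModel T v1 →
      ∀ (e0 : C → C0) (e1 : C → C1), ElemMap v v0 e0 → ElemMap v v1 e1 →
      ∃ (D : Type) (w : L.Formula D → B), IsFullBModel T w ∧
        ∃ (f0 : C0 → D) (f1 : C1 → D), ElemMap v0 w f0 ∧ ElemMap v1 w f1 ∧
          f0 ∘ e0 = f1 ∘ e1) := by
  refine ⟨?_, ?_, ?_⟩
  · intro C val hM X
    exact dls hL hM X
  · intro C0 C1 v0 v1 h0 h1
    obtain ⟨D, w, hw, f0, f1, k0, k1, -⟩ := amalgam (C := Empty) h0 h1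
      (e0 := fun e : Empty => e.elim) (e1 := fun e : Empty => e.elim)
      (fun a => a.elim) (agree_sentences hT h0 h1)
    exact ⟨D, w, hw, f0, f1, k0, k1⟩
  · intro C C0 C1 v v0 v1 h h0 h1 e0 e1 he0 he1
    exact amalgam h0 h1 (injective_of_elem h.1 h1.1.pre he1)
      (fun φ => (he0 φ).symm.trans (he1 φ))
end

section
/- Suppose T is a complete countable first-order theory, λ is an infinite cardinal, and M is a λ⁺-saturated ordinary model of T. Let M^λ be the P(λ)-valued structure whose underlying set is the set of all functions from λ to M, with ‖φ(f_0, …, f_{n-1})‖ = {α < λ : M ⊨ φ(f_0(α), …, f_{n-1}(α))}, where P(λ) is the powerset of λ regarded as a complete Boolean algebra. Then M^λ is a λ⁺-saturated full P(λ)-valued model of T. -/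
open FirstOrder FirstOrder.Language Cardinal

open BVal

namespace BVal

/-- Semantic entailment between formulas with free variables in `C`. -/
def Ent {L : FirstOrder.Language.{0, 0}} {C : Type} (φ ψ : L.Formula C) : Prop :=
  ∀ (N : Type) [L.Structure N] [Nonempty N] (v : C → N), φ.Realize v → ψ.Realize v

/-- A complete consistent set of formulas, closed under entailment. -/
structure IsCT {L : FirstOrder.Language.{0, 0}} {C : Type} (P : Set (L.Formula C)) : Prop where
  ent : ∀ φ ψ : L.Formula C, Ent φ ψ → φ ∈ P → ψ ∈ P
  not : ∀ φ : L.Formula C, φ.not ∈ P ↔ φ ∉ P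
  inf : ∀ φ ψ : L.Formula C, φ ∈ P → ψ ∈ P → φ ⊓ ψ ∈ P
  top : ∀ φ : L.Formula C,
    (∀ (N : Type) [L.Structure N] [Nonempty N] (v : C → N), φ.Realize v) → φ ∈ P

/-- A relation between `C` and `N` that is partial elementary with respect to `P`. -/
def IsElemRel {L : FirstOrder.Language.{0, 0}} {C N : Type} [L.Structure N]
    (P : Set (L.Formula C)) (R : Set (C × N)) : Prop :=
  ∀ φ : L.Formula R, φ.relabel (fun r : R => r.1.1) ∈ P → φ.Realize (fun r : R => r.1.2)

theorem isCT_of_isBVal {L : FirstOrder.Language.{0, 0}} {C X : Type} {v : L.Formula C → Set X}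
    (hv : IsBVal v) (x : X) : IsCT {φ | x ∈ v φ} := by
  obtain ⟨h1, h2, h3, -, -⟩ := hv
  refine ⟨?_, ?_, ?_, ?_⟩
  · intro φ ψ h hφ
    have := h1 (φ ⊓ ψ.not).not (by
      intro N _ _ w
      have := h N w
      simp only [Formula.realize_not, Formula.realize_inf]
      tauto)
    rw [h2, h3, h2] at this
    have hx : x ∈ (v φ ⊓ (v ψ)ᶜ)ᶜ := by rw [this]; trivial
    by_contra hψ
    exact hx ⟨hφ, hψ⟩
  · intro φ
    simp only [Set.mem_ofPred_eq, h2]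
    rfl
  · intro φ ψ hφ hψ
    simp only [Set.mem_ofPred_eq, h3]
    exact ⟨hφ, hψ⟩
  · intro φ h
    simp only [Set.mem_ofPred_eq, h1 φ h]
    trivial

section
variable {L : FirstOrder.Language.{0, 0}} {C N : Type} [L.Structure N]
  {P : Set (L.Formula C)}

theorem IsElemRel.functional (hP : IsCT P) {R : Set (C × N)} (hR : IsElemRel P R) {c : C} {m m' : N}
    (h : (c, m) ∈ R) (h' : (c, m') ∈ R) : m = m' := by
  have := hR (Term.equal (Term.var ⟨_, h⟩) (Term.var ⟨_, h'⟩)) (hP.top _ (by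
    intro K _ _ w
    simp [Formula.realize_relabel, Formula.realize_equal]))
  simpa [Formula.realize_equal] using this

theorem IsElemRel.iff (hP : IsCT P) {R : Set (C × N)} (hR : IsElemRel P R) (φ : L.Formula R) :
    φ.relabel (fun r : R => r.1.1) ∈ P ↔ φ.Realize (fun r : R => r.1.2) := by
  refine ⟨hR φ, fun h => ?_⟩
  by_contra hn
  rw [← hP.not] at hn
  have := hR φ.not (hP.ent _ _ (by
    intro K _ _ w hw
    simpa [Formula.realize_relabel, Formula.realize_not] using hw) hn)
  rw [Formula.realize_not] at this
  exact this h

theorem IsElemRel.sUnion (hP : IsCT P) {c : Set (Set (C × N))} (hc : ∀ R ∈ c, IsElemRel P R)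
    (hch : IsChain (· ⊆ ·) c) (hne : c.Nonempty) : IsElemRel P (⋃₀ c) := by
  classical
  intro φ hφ
  obtain ⟨R, hRc, hR⟩ := hch.directedOn.exists_mem_subset_of_finite_of_subset_sUnion hne
    (s := Subtype.val '' (φ.freeVarFinset : Set (⋃₀ c : Set (C × N))))
    ((Finset.finite_toSet _).image _) (by rintro _ ⟨x, -, rfl⟩; exact x.2)
  let k : φ.freeVarFinset → R := fun x => ⟨x.1.1, hR ⟨x.1, x.2, rfl⟩⟩
  let ψ : L.Formula R := BoundedFormula.restrictFreeVar φ k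
  have := hc R hRc ψ (hP.ent _ _ (by
    intro K _ _ w hw
    rw [Formula.realize_relabel] at hw ⊢
    exact (BoundedFormula.realize_restrictFreeVar (f := k) _ (fun a => rfl)).2 hw) hφ)
  exact (BoundedFormula.realize_restrictFreeVar (f := k) _ (fun a => rfl)).1 this

/-- turn a formula with distinguished variable into a bounded formula -/
def toB {A D : Type} (e : A → D) (φ : L.Formula (A ⊕ Fin 1)) : L.BoundedFormula D 1 :=
  BoundedFormula.relabel (n := 1) (k := 0) (Sum.map e id) φ

theorem realize_toB {K A D : Type} [L.Structure K] (e : A → D) (φ : L.Formula (A ⊕ Fin 1))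
    (v : D → K) (b : K) :
    (toB e φ).Realize v (fun _ => b) ↔ φ.Realize (Sum.elim (v ∘ e) fun _ => b) := by
  unfold toB Formula.Realize
  rw [BoundedFormula.realize_relabel]
  have : (Sum.elim v ((fun _ => b : Fin 1 → K) ∘ Fin.castAdd 0) ∘ Sum.map e id)
      = Sum.elim (v ∘ e) fun _ => b := by
    ext (x | x) <;> rfl
  rw [this]
  exact iff_of_eq (congrArg _ (Subsingleton.elim _ _))

theorem IsElemRel.extend (hP : IsCT P) {lam : Cardinal} (hC : Cardinal.mk C ≤ lam)
    (hsat : OrdSaturated L lam N) {R : Set (C × N)} (hR : IsElemRel P R) (c : C) :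
    ∃ b : N, IsElemRel P (insert (c, b) R) := by
  classical
  let A : Set N := Prod.snd '' R
  have hA : Cardinal.mk A ≤ lam := by
    refine le_trans ?_ hC
    choose k hk1 hk2 using fun a : A => a.2
    refine Cardinal.mk_le_of_injective (f := fun a => (k a).1) ?_
    intro a a' h
    have h1 : ((k a).1, (a : N)) ∈ R := by
      have := hk1 a
      rw [← hk2 a]
      exact this
    have h2 : ((k a).1, (a' : N)) ∈ R := by
      have := hk1 a'
      simp only at h
      rw [h, ← hk2 a']
      exact this
    exact Subtype.ext (hR.functional hP h1 h2)
  let e : R → A := fun r => ⟨r.1.2, r.1, r.2, rfl⟩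
  let q : R ⊕ Fin 1 → C := Sum.elim (fun r => r.1.1) (fun _ => c)
  obtain ⟨b, hb⟩ := hsat A hA {ψ | ∃ φ : L.Formula (R ⊕ Fin 1), φ.relabel q ∈ P ∧ ψ = toB e φ} (by
    intro s hs
    have key : ∃ φ : L.Formula (R ⊕ Fin 1), φ.relabel q ∈ P ∧
        ∀ b : N, φ.Realize (Sum.elim (fun r : R => r.1.2) fun _ => b) →
          ∀ ψ ∈ s, BoundedFormula.Realize ψ Subtype.val fun _ => b := by
      induction s using Finset.induction_on with
      | empty =>
        refine ⟨⊤, hP.top _ ?_, by simp⟩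
        intro K _ _ w
        simp [Formula.realize_relabel]
      | insert ψ s _ ih =>
        obtain ⟨φ, hφ, hφs⟩ := ih (fun x hx => hs (by simp at hx ⊢; exact Or.inr hx))
        obtain ⟨θ, hθ, rfl⟩ := hs (Finset.mem_coe.2 (Finset.mem_insert_self ψ s))
        refine ⟨θ ⊓ φ, hP.ent _ _ ?_ (hP.inf _ _ hθ hφ), ?_⟩
        · intro K _ _ w hw
          simpa [Formula.realize_relabel, Formula.realize_inf] using hw
        · intro b hb ψ' hψ'
          rw [Formula.realize_inf] at hb
          rcases Finset.mem_insert.1 hψ' with rfl | h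
          · exact (realize_toB _ _ _ _).2 hb.1
          · exact hφs b hb.2 _ h
    obtain ⟨φ, hφ, hφs⟩ := key
    have hex := hR (toB id φ).ex (hP.ent _ _ (by
      intro K _ _ w hw
      rw [Formula.realize_relabel] at hw ⊢
      refine BoundedFormula.realize_ex.2 ⟨w c, ?_⟩
      have h0 : (Fin.snoc (default : Fin 0 → K) (w c) : Fin 1 → K) = fun _ => w c := by
        ext i; fin_cases i; rfl
      rw [h0]
      refine (realize_toB _ _ _ _).2 ?_
      convert hw using 1
      ext (x | x) <;> rfl) hφ)
    obtain ⟨b, hb⟩ := BoundedFormula.realize_ex.1 hex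
    have h0 : (Fin.snoc (default : Fin 0 → N) b : Fin 1 → N) = fun _ => b := by
      ext i; fin_cases i; rfl
    rw [h0] at hb
    exact ⟨b, hφs b ((realize_toB id _ _ _).1 hb)⟩)
  refine ⟨b, fun φ hφ => ?_⟩
  let t : (insert (c, b) R : Set (C × N)) → R ⊕ Fin 1 := fun x =>
    if h : x.1 ∈ R then Sum.inl ⟨x.1, h⟩ else Sum.inr 0
  have ht : ∀ x, q (t x) = x.1.1 ∧
      Sum.elim (fun r : R => r.1.2) (fun _ => b) (t x) = x.1.2 := by
    intro x
    by_cases h : x.1 ∈ R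
    · simp [t, q, h]
    · have := x.2
      rcases Set.mem_insert_iff.1 this with h' | h'
      · simp [t, q, h]
        rw [h']
        exact ⟨rfl, rfl⟩
      · exact absurd h' h
  have := hb _ ⟨φ.relabel t, hP.ent _ _ (by
    intro K _ _ w hw
    rw [Formula.realize_relabel] at hw
    rw [Formula.realize_relabel, Formula.realize_relabel]
    convert hw using 1
    ext x
    simp [(ht x).1]) hφ, rfl⟩
  rw [realize_toB, Formula.realize_relabel] at this
  convert this using 1
  ext x
  exact ((ht x).2).symm

theorem exists_total (hP : IsCT P) {lam : Cardinal} (hC : Cardinal.mk C ≤ lam)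
    (hsat : OrdSaturated L lam N) {R : Set (C × N)} (hR : IsElemRel P R) :
    ∃ g : C → N, (∀ φ : L.Formula C, φ ∈ P ↔ φ.Realize g) ∧ ∀ r ∈ R, g r.1 = r.2 := by
  obtain ⟨S, hRS, hS⟩ := zorn_subset_nonempty {R : Set (C × N) | IsElemRel P R}
    (fun c hc hch hne => ⟨⋃₀ c, IsElemRel.sUnion hP hc hch hne,
      fun s hs => Set.subset_sUnion_of_mem hs⟩) R hR
  have hSel : IsElemRel P S := hS.prop
  have htot : ∀ c, ∃ b, (c, b) ∈ S := by
    intro c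
    obtain ⟨b, hb⟩ := hSel.extend hP hC hsat c
    exact ⟨b, hS.le_of_ge hb (Set.subset_insert _ _) (Set.mem_insert _ _)⟩
  choose g hg using htot
  refine ⟨g, fun φ => ?_, fun r hr => hSel.functional hP (hg r.1) (hRS hr)⟩
  have := hSel.iff hP (φ.relabel fun c => (⟨(c, g c), hg c⟩ : S))
  rw [Formula.realize_relabel] at this
  refine Iff.trans ⟨hP.ent _ _ ?_, hP.ent _ _ ?_⟩ this
  · intro K _ _ w hw
    rw [Formula.realize_relabel, Formula.realize_relabel]
    exact hw
  · intro K _ _ w hw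
    rw [Formula.realize_relabel, Formula.realize_relabel] at hw
    exact hw

theorem realize_plug {D : Type} (φ : L.BoundedFormula D 1) (b : D) (v : D → N) :
    (plug φ fun _ => b).Realize v ↔ φ.Realize v (fun _ => v b) := by
  unfold plug plugEmb
  rw [Formula.realize_relabel, BoundedFormula.realize_toFormula]
  rfl

theorem realize_ex1 {D : Type} (φ : L.BoundedFormula D 1) (v : D → N) :
    Formula.Realize φ.ex v ↔ ∃ b : N, φ.Realize v (fun _ => b) := by
  have h0 (b : N) : (Fin.snoc (default : Fin 0 → N) b : Fin 1 → N) = fun _ => b := by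
    ext i; fin_cases i; rfl
  refine BoundedFormula.realize_ex.trans ?_
  simp only [h0]

end

end BVal

/-- **If `M ⊨ T` is `λ⁺`-saturated then the power `M^λ` is a `λ⁺`-saturated full
`P(λ)`-valued model of `T`** (Example 3.12). -/
theorem stmt3_power_saturated (L : FirstOrder.Language.{0, 0}) (hL : L.card ≤ ℵ₀)
    (T : L.Theory) (hT : T.IsComplete) (lam : Cardinal) (hlam : ℵ₀ ≤ lam)
    (M : OrdStructure L) (hMT : M.carrier ⊨ T) (hMsat : OrdSaturated L lam M.carrier) :
    IsFullBModel (B := Set (Quotient.out lam)) T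
      (fun φ : L.Formula (Quotient.out lam → M.carrier) =>
        {α : Quotient.out lam | φ.Realize fun f => f α}) ∧
    BSaturated (B := Set (Quotient.out lam)) T lam
      (fun φ : L.Formula (Quotient.out lam → M.carrier) =>
        {α : Quotient.out lam | φ.Realize fun f => f α}) := by
  have hfull : IsFull (B := Set (Quotient.out lam))
      (fun φ : L.Formula (Quotient.out lam → M.carrier) =>
        {α : Quotient.out lam | φ.Realize fun f => f α}) := by
    intro φ
    have : ∀ α : Quotient.out lam, ∃ b : M.carrier, Formula.Realize φ.ex (fun f => f α) →
        φ.Realize (fun f => f α) (fun _ => b) := by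
      intro α
      by_cases h : Formula.Realize φ.ex (fun f : Quotient.out lam → M.carrier => f α)
      · obtain ⟨b, hb⟩ := (realize_ex1 _ _).1 h
        exact ⟨b, fun _ => hb⟩
      · exact ⟨Classical.arbitrary _, fun h' => absurd h' h⟩
    choose a ha using this
    refine ⟨a, Set.ext fun α => ?_⟩
    simp only [Set.mem_ofPred_eq, realize_plug]
    exact ⟨ha α, fun h => (realize_ex1 _ _).2 ⟨_, h⟩⟩
  refine ⟨⟨⟨?_, ?_, ?_, ?_, ?_⟩, hfull, ?_⟩, ?_⟩
  · intro φ h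
    exact Set.eq_univ_of_forall fun α => h M.carrier _
  · intro φ
    ext α
    simp [Formula.realize_not]
  · intro φ ψ
    ext α
    simp [Formula.realize_inf]
  · intro φ
    apply le_antisymm
    · obtain ⟨a, ha⟩ := hfull φ
      rw [ha]
      exact le_iSup (fun a : Quotient.out lam → M.carrier =>
        {α : Quotient.out lam | (plug φ fun _ => a).Realize fun f => f α}) a
    · refine iSup_le fun a α h => ?_
      simp only [Set.mem_ofPred_eq, realize_plug] at h ⊢
      exact (realize_ex1 _ _).2 ⟨_, h⟩
  · intro a b hab
    refine lt_top_iff_ne_top.2 fun h => hab (funext fun α => ?_)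
    have : α ∈ {α : Quotient.out lam | (Term.equal (L := L) (Term.var a) (Term.var b)).Realize
        fun f : Quotient.out lam → M.carrier => f α} := by
      exact h.ge trivial
    simpa [Formula.realize_equal] using this
  · intro φ hφ
    refine Set.eq_univ_of_forall fun α => ?_
    have := hMT.realize_of_mem φ hφ
    simp only [Set.mem_ofPred_eq, Formula.realize_relabel]
    rw [Sentence.Realize] at this
    convert this
  · intro C0 C1 v0 v1 h0 h1 hC ι hι f hf
    have key : ∀ α : Quotient.out lam, ∃ g : C1 → M.carrier,
        (∀ φ : L.Formula C1, α ∈ v1 φ ↔ φ.Realize g) ∧ ∀ c, g (ι c) = f c α := by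
      intro α
      have hP := isCT_of_isBVal h1.1 α
      have hR : IsElemRel {φ | α ∈ v1 φ} (Set.range fun c => (ι c, f c α)) := by
        intro φ hφ
        choose k hk using fun r : (Set.range fun c => (ι c, f c α)) => r.2
        have hk1 : ∀ r, ι (k r) = r.1.1 := fun r => congrArg Prod.fst (hk r)
        have hk2 : ∀ r, f (k r) α = r.1.2 := fun r => congrArg Prod.snd (hk r)
        have h2 : α ∈ v1 ((φ.relabel k).relabel ι) := hP.ent _ _ (by
          intro K _ _ w hw
          rw [Formula.realize_relabel] at hw
          rw [Formula.realize_relabel, Formula.realize_relabel]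
          convert hw using 1
          ext x
          simp [hk1 x]) hφ
        rw [← hι, hf] at h2
        simp only [Set.mem_ofPred_eq, Formula.realize_relabel] at h2
        convert h2 using 1
        ext x
        exact (hk2 x).symm
      obtain ⟨g, hg1, hg2⟩ := exists_total hP hC hMsat hR
      exact ⟨g, hg1, fun c => hg2 _ ⟨c, rfl⟩⟩
    choose g hg1 hg2 using key
    refine ⟨fun c α => g α c, fun φ => Set.ext fun α => ?_, funext fun c => funext fun α => hg2 α c⟩
    simp only [Set.mem_ofPred_eq, Formula.realize_relabel]
    exact hg1 α φ
end

section
/- Finitary criterion for Łoś maps: Suppose B is a complete Boolean algebra, T is a complete countable theory, λ is an infinite cardinal, A is a λ-distribution in B, and φ̄ = (φ_α(x̄, ȳ_α) : α < λ) is a λ-sequence of formulas. Then the following are equivalent: (A) A is a (λ, T, φ̄)-Łoś map; (B) for every finite s ⊆ λ and every nonzero c ∈ B such that for every t ⊆ s either c ≤ A(t) or c ≤ ¬A(t), there exist an ordinary model M of T and tuples (ā_α : α ∈ s) from M such that for each t ⊆ s, M ⊨ ∃x̄ ⋀_{α∈t} φ_α(x̄, ā_α) if and only if c ≤ A(t).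 -/
open FirstOrder FirstOrder.Language Cardinal

open BVal

namespace LosProof

theorem realize_listConj {L : FirstOrder.Language.{0, 0}} {α N : Type} [L.Structure N] {n : ℕ}
    (l : List (L.BoundedFormula α n)) (v : α → N) (xs : Fin n → N) :
    (listConj l).Realize v xs ↔ ∀ φ ∈ l, φ.Realize v xs := by
  induction l with
  | nil => simp [listConj]
  | cons φ l ih => simp [listConj, ih]

theorem realize_los {L : FirstOrder.Language.{0, 0}} {C I N : Type} [L.Structure N]
    (Φ : FormulaSeq L I) (a : ∀ i, Fin (Φ.m i) → C) (s : Finset I) (v : C → N) :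
    (losFormula Φ a s).Realize v ↔
      ∃ x : Fin Φ.n → N, ∀ i ∈ s, (Φ.φ i).Realize (Sum.elim x fun j => v (a i j)) := by
  unfold losFormula
  rw [BoundedFormula.realize_exs]
  refine exists_congr fun x => ?_
  rw [realize_listConj]
  simp only [List.mem_map, Finset.mem_toList, forall_exists_index, and_imp,
    forall_apply_eq_imp_iff₂]
  refine forall₂_congr fun i _ => ?_
  have h := BoundedFormula.realize_relabel (L := L) (M := N) (m := Φ.n) (n := 0) (φ := Φ.φ i)
    (g := fun w : Fin Φ.n ⊕ Fin (Φ.m i) =>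
        Sum.elim (fun k => Sum.inr k) (fun j => Sum.inl (a i j)) w) (v := v) (xs := x)
  refine h.trans ?_
  unfold Formula.Realize
  have e1 : (Sum.elim v (x ∘ Fin.castAdd 0) ∘ fun w : Fin Φ.n ⊕ Fin (Φ.m i) =>
        Sum.elim (fun k => Sum.inr k) (fun j => Sum.inl (a i j)) w)
        = Sum.elim x fun j => v (a i j) := by
    funext w
    rcases w with w | w <;> rfl
  rw [e1]
  exact iff_of_eq (congrArg _ (Subsingleton.elim _ _))

theorem realize_plug {L : FirstOrder.Language.{0, 0}} {C N : Type} [L.Structure N]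
    (φ : L.BoundedFormula C 1) (a : C) (v : C → N) :
    (plug φ fun _ => a).Realize v ↔ φ.Realize v fun _ => v a := by
  unfold plug plugEmb
  rw [Formula.realize_relabel, BoundedFormula.realize_toFormula]
  rfl

/-- Boolean-valued filters. -/
structure IsBF {F B : Type} [BooleanAlgebra F] [CompleteBooleanAlgebra B] (p : F → B) : Prop where
  top : p ⊤ = ⊤
  bot : p ⊥ = ⊥
  inf : ∀ x y, p (x ⊓ y) = p x ⊓ p y

theorem IsBF.mono {F B : Type} [BooleanAlgebra F] [CompleteBooleanAlgebra B] {p : F → B}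
    (h : IsBF p) {x y : F} (hxy : x ≤ y) : p x ≤ p y := by
  have := h.inf x y
  rw [inf_eq_left.2 hxy] at this
  rw [this]; exact inf_le_right

theorem isBF_iSup {F B ι : Type*} [Nonempty ι] [CompleteBooleanAlgebra B]
    [Min F] (p : ι → F → B) (hd : Directed (· ≤ ·) p)
    (h : ∀ i x y, p i (x ⊓ y) = p i x ⊓ p i y) (x y : F) :
    (⨆ i, p i (x ⊓ y)) = (⨆ i, p i x) ⊓ ⨆ i, p i y := by
  apply le_antisymm
  · refine iSup_le fun i => ?_
    rw [h]
    exact inf_le_inf (le_iSup (fun i => p i x) i) (le_iSup (fun i => p i y) i)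
  · rw [iSup_inf_eq]
    refine iSup_le fun i => ?_
    rw [inf_iSup_eq]
    refine iSup_le fun j => ?_
    obtain ⟨k, hik, hjk⟩ := hd i j
    refine le_trans ?_ (le_iSup (fun i => p i (x ⊓ y)) k)
    rw [h]
    exact inf_le_inf (hik x) (hjk y)

/-- Every Boolean-valued filter extends to a Boolean-valued ultrafilter. -/
theorem exists_ultra {F B : Type} [BooleanAlgebra F] [CompleteBooleanAlgebra B] (p₀ : F → B)
    (h₀ : IsBF p₀) : ∃ p : F → B, IsBF p ∧ p₀ ≤ p ∧ ∀ x, p xᶜ = (p x)ᶜ := by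
  obtain ⟨p, hle, hmax⟩ := zorn_le_nonempty₀ {p : F → B | IsBF p} (by
    intro c hc hchain y hy
    have : Nonempty c := ⟨⟨y, hy⟩⟩
    refine ⟨fun x => ⨆ i : c, i.1 x, ⟨?_, ?_, ?_⟩, ?_⟩
    · simp [fun i : c => (hc i.2).top]
    · simp [fun i : c => (hc i.2).bot]
    · exact isBF_iSup (fun i : c => i.1) hchain.directed fun i => (hc i.2).inf
    · intro z hz x
      exact le_iSup (fun i : c => i.1 x) ⟨z, hz⟩) p₀ h₀
  have hp : IsBF p := hmax.prop
  refine ⟨p, hp, hle, fun x => ?_⟩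
  have key : (p xᶜ)ᶜ ≤ p x := by
    have hq : IsBF fun y => p (xᶜ ⊔ y) ⊓ (p y ⊔ (p xᶜ)ᶜ) := by
      refine ⟨by simp [hp.top], by simp [hp.bot], fun y z => ?_⟩
      rw [sup_inf_left, hp.inf, hp.inf, sup_inf_right]
      ac_rfl
    have hpq : p ≤ fun y => p (xᶜ ⊔ y) ⊓ (p y ⊔ (p xᶜ)ᶜ) := fun y =>
      le_inf (hp.mono le_sup_right) le_sup_left
    have := hmax.le_of_ge hq hpq x
    simp only [compl_sup_eq_top, hp.top, top_inf_eq] at this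
    exact le_sup_right.trans this
  have hdisj : p x ⊓ p xᶜ = ⊥ := by rw [← hp.inf, inf_compl_self, hp.bot]
  apply le_antisymm
  · exact (disjoint_iff.2 hdisj).symm.le_compl_right
  · exact compl_le_iff_compl_le.1 key

/-- Elements deciding every member of a finite set are dense. -/
theorem exists_decide {B ι : Type} [CompleteBooleanAlgebra B] (A : ι → B) (S : Finset ι) (b : B)
    (hb : b ≠ ⊥) : ∃ c ≤ b, c ≠ ⊥ ∧ ∀ t ∈ S, c ≤ A t ∨ c ≤ (A t)ᶜ := by
  classical
  induction S using Finset.induction_on with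
  | empty => exact ⟨b, le_rfl, hb, by simp⟩
  | insert t S _ ih =>
    obtain ⟨c, hcb, hc, h⟩ := ih
    by_cases h1 : c ⊓ A t = ⊥
    · refine ⟨c, hcb, hc, fun u hu => ?_⟩
      rcases Finset.mem_insert.1 hu with rfl | hu
      · exact Or.inr (disjoint_iff.2 h1).le_compl_right
      · exact h u hu
    · refine ⟨c ⊓ A t, inf_le_left.trans hcb, h1, fun u hu => ?_⟩
      rcases Finset.mem_insert.1 hu with rfl | hu
      · exact Or.inl inf_le_right
      · exact (h u hu).imp inf_le_left.trans inf_le_left.trans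

section forward

variable {B : Type} [CompleteBooleanAlgebra B] {L : FirstOrder.Language.{0, 0}} {C : Type}

theorem val_listConj {val : L.Formula C → B} (h : IsBVal val) (c : B) (l : List (L.Formula C))
    (hl : ∀ φ ∈ l, c ≤ val φ) : c ≤ val (listConj l) := by
  induction l with
  | nil =>
    have : val (listConj []) = ⊤ := h.1 _ fun N _ _ v => by
      simp [listConj, Formula.Realize]
    simp [this]
  | cons φ l ih =>
    have := h.2.2.1 φ (listConj l)
    simp only [listConj]
    exact (le_inf (hl φ (by simp)) (ih fun ψ hψ => hl ψ (by simp [hψ]))).trans this.ge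

theorem exists_model {val : L.Formula C → B} (h : IsBVal val) (c : B) (hc : c ≠ ⊥) :
    ∃ (M : OrdStructure L) (v : C → M.carrier), ∀ φ, c ≤ val φ → φ.Realize v := by
  classical
  let Th : (L[[C]]).Theory := Formula.equivSentence '' {φ : L.Formula C | c ≤ val φ}
  have hsat : Th.IsSatisfiable := by
    rw [Theory.isSatisfiable_iff_isFinitelySatisfiable]
    intro T0 hT0
    by_contra hno
    let l := T0.toList.map Formula.equivSentence.symm
    have hl : ∀ φ ∈ l, c ≤ val φ := by
      intro φ hφ
      simp only [l, List.mem_map, Finset.mem_toList] at hφ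
      obtain ⟨σ, hσ, rfl⟩ := hφ
      obtain ⟨ψ, hψ, rfl⟩ := hT0 hσ
      simpa using hψ
    have h1 := val_listConj h c l hl
    have h2 : val (listConj l : L.Formula C).not = ⊤ := by
      refine h.1 _ fun N _ _ v => ?_
      rw [Formula.realize_not]
      intro hr
      apply hno
      letI : (constantsOn C).Structure N := constantsOn.structure v
      have : N ⊨ (T0 : (L[[C]]).Theory) := by
        rw [Theory.model_iff]
        intro σ hσ
        have := (realize_listConj l v default).1 hr (Formula.equivSentence.symm σ)
          (by simp only [l, List.mem_map, Finset.mem_toList]; exact ⟨σ, hσ, rfl⟩)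
        have h3 := Formula.realize_equivSentence N (Formula.equivSentence.symm σ : L.Formula C)
        rw [Equiv.apply_symm_apply] at h3
        exact h3.2 this
      exact Theory.Model.isSatisfiable N
    rw [h.2.1, compl_eq_top] at h2
    exact hc (le_bot_iff.1 (h2 ▸ h1))
  obtain ⟨N⟩ := hsat
  letI : L.Structure N := (lhomWithConstants L C).reduct N
  haveI : (lhomWithConstants L C).IsExpansionOn N := LHom.isExpansionOn_reduct _ _
  refine ⟨⟨N⟩, fun a => (L.con a : N), fun φ hφ => ?_⟩
  have h1 : N ⊨ Formula.equivSentence φ := N.is_model.realize_of_mem _ ⟨φ, hφ, rfl⟩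
  exact (Formula.realize_equivSentence N φ).1 h1

end forward

section backward

variable {B : Type} [CompleteBooleanAlgebra B] {L : FirstOrder.Language.{0, 0}} {I : Type}

def K (A : Finset I → B) : Type :=
  {x : Finset I × B // x.2 ≠ ⊥ ∧ ∀ t ⊆ x.1, x.2 ≤ A t ∨ x.2 ≤ (A t)ᶜ}

/-- Boolean value of a set of indices, forced below `s`. -/
def ps (A : Finset I → B) (s : Finset I) (X : Set (K A)) : B :=
  ⨅ k : {k : K A // s ⊆ k.1.1 ∧ k ∉ X}, (k.1.1.2)ᶜ

theorem ps_le {A : Finset I → B} {s : Finset I} {X : Set (K A)} (k : K A) (h1 : s ⊆ k.1.1)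
    (h2 : k ∉ X) : ps A s X ≤ (k.1.2)ᶜ :=
  iInf_le (fun k : {k : K A // s ⊆ k.1.1 ∧ k ∉ X} => (k.1.1.2)ᶜ) ⟨k, h1, h2⟩

theorem isBF_p0 (A : Finset I → B) : IsBF (fun X : Set (K A) => ⨆ s, ps A s X) := by
  classical
  refine ⟨?_, ?_, ?_⟩
  · refine top_le_iff.1 (le_trans ?_ (le_iSup _ ∅))
    exact le_iInf fun k => absurd trivial k.2.2
  · refine le_bot_iff.1 (iSup_le fun s => ?_)
    by_contra hne
    obtain ⟨c, hcb, hc, hdec⟩ := exists_decide A s.powerset (ps A s ⊥) (fun h => hne h.le)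
    have := ps_le (A := A) (s := s) (X := ⊥)
      ⟨(s, c), hc, fun t ht => hdec t (Finset.mem_powerset.2 ht)⟩ (Finset.Subset.refl s) (fun h => h)
    have h2 : c ≤ cᶜ := hcb.trans this
    exact hc (by simpa using h2)
  · refine isBF_iSup (fun s => ps A s) ?_ ?_
    · intro s t
      refine ⟨s ∪ t, fun X => ?_, fun X => ?_⟩
      · exact le_iInf fun k => ps_le k.1 (Finset.union_subset_left k.2.1) k.2.2
      · exact le_iInf fun k => ps_le k.1 (Finset.union_subset_right k.2.1) k.2.2
    · intro s X Y
      apply le_antisymm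
      · refine le_inf ?_ ?_
        · exact le_iInf fun k => ps_le k.1 k.2.1 fun h => k.2.2 h.1
        · exact le_iInf fun k => ps_le k.1 k.2.1 fun h => k.2.2 h.2
      · refine le_iInf fun k => ?_
        by_cases hX : k.1 ∈ X
        · exact inf_le_right.trans (ps_le k.1 k.2.1 fun h => k.2.2 ⟨hX, h⟩)
        · exact inf_le_left.trans (ps_le k.1 k.2.1 hX)

/-- The Boolean-valued ultraproduct. -/
theorem ultraproduct {κ : Type} (M : κ → OrdStructure L) (T : L.Theory)
    (hM : ∀ k, (M k).carrier ⊨ T) (p : Set κ → B) (hp : IsBF p) (hc : ∀ X, p Xᶜ = (p X)ᶜ)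
    (Φ : FormulaSeq L I) (a : ∀ k i, Fin (Φ.m i) → (M k).carrier) :
    IsLosMapFor T (fun s => p {k | (losFormula Φ (a k) s).Realize (id : (M k).carrier → _)}) Φ := by
  classical
  let S : Setoid (∀ k, (M k).carrier) :=
    { r := fun f g => p {k | f k = g k} = ⊤
      iseqv := by
        refine ⟨fun f => ?_, fun {f g} h => ?_, fun {f g h} h1 h2 => ?_⟩
        · simpa using hp.top
        · simpa only [eq_comm] using h
        · refine top_le_iff.1 ?_
          have := hp.inf {k | f k = g k} {k | g k = h k}
          rw [h1, h2, top_inf_eq] at this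
          rw [← this]
          exact hp.mono fun k hk => hk.1.trans hk.2 }
  let C := Quotient S
  have hout : ∀ f : ∀ k, (M k).carrier, p {k | (Quotient.mk S f).out k = f k} = ⊤ :=
    fun f => Quotient.mk_out (s := S) f
  let v : ∀ k, C → (M k).carrier := fun k c => c.out k
  let val : L.Formula C → B := fun φ => p {k | φ.Realize (v k)}
  have hcongr : ∀ X Y D : Set κ, p D = ⊤ → (∀ k ∈ D, k ∈ X → k ∈ Y) → p X ≤ p Y := by
    intro X Y D hD h
    have h1 : p X = p (X ⊓ D) := by rw [hp.inf, hD, inf_top_eq]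
    rw [h1]
    exact hp.mono fun k hk => h k hk.2 hk.1
  have hexle : ∀ (φ : L.BoundedFormula C 1) (c : C), val (plug φ fun _ => c) ≤ val φ.ex := by
    intro φ c
    refine hp.mono fun k hk => ?_
    have h := (realize_plug φ c (v k)).1 hk
    refine BoundedFormula.realize_ex.2 ⟨v k c, ?_⟩
    convert h using 1
    funext i
    fin_cases i
    rfl
  have hex : ∀ φ : L.BoundedFormula C 1, ∃ c : C, val φ.ex = val (plug φ fun _ => c) := by
    intro φ
    have : ∀ k, ∃ y : (M k).carrier, φ.ex.Realize (v k) default → φ.Realize (v k) fun _ => y := by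
      intro k
      by_cases h : φ.ex.Realize (v k) default
      · obtain ⟨y, hy⟩ := BoundedFormula.realize_ex.1 h
        refine ⟨y, fun _ => ?_⟩
        convert hy using 1
        funext i
        fin_cases i
        rfl
      · exact ⟨Classical.arbitrary _, fun h' => absurd h' h⟩
    choose f hf using this
    refine ⟨Quotient.mk S f, le_antisymm ?_ (hexle _ _)⟩
    refine hcongr _ _ _ (hout f) fun k hk h => ?_
    refine (realize_plug φ _ (v k)).2 ?_
    have hk' : v k (Quotient.mk S f) = f k := hk
    rw [hk']
    exact hf k h
  refine ⟨C, val, ⟨⟨?_, ?_, ?_, ?_, ?_⟩, hex, ?_⟩, fun i j => Quotient.mk S fun k => a k i j, ?_⟩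
  · intro φ h
    have : {k | φ.Realize (v k)} = ⊤ := Set.eq_univ_of_forall fun k => h _ _
    simp only [val, this, hp.top]
  · intro φ
    simp only [val]
    rw [← hc]
    rfl
  · intro φ ψ
    simp only [val]
    rw [← hp.inf]
    congr 1
    ext k
    exact Formula.realize_inf
  · intro φ
    apply le_antisymm
    · obtain ⟨c, h⟩ := hex φ
      rw [h]
      exact le_iSup (fun a : C => val (plug φ fun _ => a)) c
    · exact iSup_le (hexle φ)
  · intro x y hxy
    refine lt_top_iff_ne_top.2 fun h => hxy ?_
    rw [← Quotient.out_eq x, ← Quotient.out_eq y]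
    refine Quotient.sound (s := S) ?_
    refine Eq.trans ?_ h
    simp only [val]
    congr 1
  · intro φ hφ
    have : {k | (Formula.relabel (fun e : Empty => (e.elim : C)) φ).Realize (v k)} = ⊤ := by
      refine Set.eq_univ_of_forall fun k => ?_
      have h := (hM k).realize_of_mem φ hφ
      refine Formula.realize_relabel.2 ?_
      unfold Sentence.Realize at h
      convert h using 1
    simp only [val, this, hp.top]
  · intro s
    let E : (i : I) → Fin (Φ.m i) → Set κ := fun i j =>
      {k | (Quotient.mk S fun k => a k i j).out k = a k i j}
    have hfin : ∀ {ι : Type} (J : Finset ι) (G : ι → Set κ), (∀ i, p (G i) = ⊤) →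
        p (J.inf G) = ⊤ := by
      intro ι J G hG
      induction J using Finset.induction_on with
      | empty => simpa using hp.top
      | insert i J _ ih => rw [Finset.inf_insert, hp.inf, hG, ih, top_inf_eq]
    let D : Set κ := s.inf fun i => Finset.univ.inf (E i)
    have hD : p D = ⊤ := hfin _ _ fun i => hfin _ _ fun j => hout _
    have hD' : ∀ k ∈ D, ∀ i ∈ s, ∀ j, v k (Quotient.mk S fun k => a k i j) = a k i j := by
      intro k hk i hi j
      have : D ≤ E i j := (Finset.inf_le hi).trans (Finset.inf_le (Finset.mem_univ j))
      exact this hk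
    have hiff : ∀ k ∈ D, ((losFormula Φ (a k) s).Realize (id : (M k).carrier → _) ↔
        (losFormula Φ (fun i j => Quotient.mk S fun k => a k i j) s).Realize (v k)) := by
      intro k hk
      rw [realize_los, realize_los]
      refine exists_congr fun x => forall₂_congr fun i hi => ?_
      have : (fun j => v k (Quotient.mk S fun k => a k i j)) = fun j => id (a k i j) :=
        funext fun j => hD' k hk i hi j
      rw [this]
    exact le_antisymm (hcongr _ _ D hD fun k hk => (hiff k hk).1)
      (hcongr _ _ D hD fun k hk => (hiff k hk).2)

end backward

end LosProof

/-- **Finitary criterion for being a Łoś map** (Theorem 4.9). -/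
theorem stmt5_los_map_criterion (B : Type) [CompleteBooleanAlgebra B]
    (L : FirstOrder.Language.{0, 0}) (hL : L.card ≤ ℵ₀)
    (T : L.Theory) (hT : T.IsComplete) (lam : Cardinal) (hlam : ℵ₀ ≤ lam)
    (A : Finset (Quotient.out lam) → B) (hA : IsDistribution A)
    (Φ : FormulaSeq L (Quotient.out lam)) :
    IsLosMapFor T A Φ ↔
      ∀ (s : Finset (Quotient.out lam)) (c : B), c ≠ ⊥ →
        (∀ t ⊆ s, c ≤ A t ∨ c ≤ (A t)ᶜ) →
        ∃ M : OrdStructure L, M.carrier ⊨ T ∧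
          ∃ a : ∀ i, Fin (Φ.m i) → M.carrier,
            ∀ t ⊆ s, ((losFormula Φ a t).Realize (id : M.carrier → M.carrier) ↔ c ≤ A t) := by
  constructor
  · rintro ⟨C, val, ⟨hval, _, hmod⟩, a, ha⟩ s c hc hdec
    obtain ⟨M, v, hv⟩ := LosProof.exists_model hval c hc
    refine ⟨M, ?_, fun i j => v (a i j), fun t ht => ?_⟩
    · rw [Theory.model_iff]
      intro φ hφ
      have h := hv _ (by rw [hmod φ hφ]; exact le_top)
      have h' := Formula.realize_relabel.1 h
      unfold Sentence.Realize
      convert h' using 1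
    · have e : (losFormula Φ (fun i j => v (a i j)) t).Realize (id : M.carrier → M.carrier) ↔
          (losFormula Φ a t).Realize v := by
        rw [LosProof.realize_los, LosProof.realize_los]
        rfl
      rw [e]
      constructor
      · intro h
        rcases hdec t ht with h1 | h1
        · exact h1
        · rw [ha, ← hval.2.1] at h1
          exact absurd h (Formula.realize_not.1 (hv _ h1))
      · intro h
        rw [ha] at h
        exact hv _ h
  · intro h
    have h' : ∀ k : LosProof.K A, ∃ M : OrdStructure L, M.carrier ⊨ T ∧
          ∃ a : ∀ i, Fin (Φ.m i) → M.carrier,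
            ∀ t ⊆ k.1.1, ((losFormula Φ a t).Realize (id : M.carrier → M.carrier) ↔
              k.1.2 ≤ A t) := fun k => h k.1.1 k.1.2 k.2.1 k.2.2
    choose M hM a ha using h'
    obtain ⟨p, hp, hle, hc⟩ := LosProof.exists_ultra _ (LosProof.isBF_p0 A)
    have key := LosProof.ultraproduct M T hM p hp hc Φ a
    have : (fun s => p {k | (losFormula Φ (a k) s).Realize (id : (M k).carrier → _)}) = A := by
      funext t
      apply le_antisymm
      · rw [← compl_le_compl_iff_le, ← hc]
        refine le_trans ?_ (hle _)
        refine le_trans ?_ (le_iSup (fun s => LosProof.ps A s _) t)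
        refine le_iInf fun k => ?_
        rw [compl_le_compl_iff_le]
        have h1 := k.2.2
        simp only [Set.mem_compl_iff, Set.mem_setOf_eq, not_not] at h1
        exact (ha k.1 t k.2.1).1 h1
      · refine le_trans ?_ (hle _)
        refine le_trans ?_ (le_iSup (fun s => LosProof.ps A s _) t)
        refine le_iInf fun k => ?_
        have h1 := k.2.2
        simp only [Set.mem_setOf_eq] at h1
        rw [ha k.1 t k.2.1] at h1
        exact le_compl_comm.1 ((k.1.2.2 t k.2.1).resolve_left h1)
    rw [this] at key
    exact key
end
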